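/- arXiv:2203.10312 — 3 statements merged into one kernel-verified Lean document; each statement's English description precedes it below -/
import Mathlib

section
/- Let N ≥ 2, s ∈ (0,1) and m ∈ ℕ. Then ℋ_m^s(ℝ^N) = ℋ_m^1(ℝ^N); that is, a homogeneous polynomial u of degree m on ℝ^N satisfies lim_{ε→0^+} c_{N,s} ∫_{{z : ε < |z| < 1/ε}} (u(x) − u(x+z)) |z|^{−N−2s} dz = 0 for every x ∈ ℝ^N if and only if u is harmonic (Δu = 0 on ℝ^N). -/
open MeasureTheory Real Filter Set Topology

noncomputable section

/-- The normalizing constant `c_{N,s}` of the fractional Laplacian. -/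
def cns (N : ℕ) (s : ℝ) : ℝ :=
  (2 : ℝ) ^ (2 * s) * Real.pi ^ (-(N : ℝ) / 2) * s *
    Real.Gamma (((N : ℝ) + 2 * s) / 2) / Real.Gamma (1 - s)

/-- The annulus `{z : ε < |z| < 1/ε}` in `ℝ^N`. -/
def annulus (N : ℕ) (ε : ℝ) : Set (EuclideanSpace ℝ (Fin N)) :=
  {z | ε < ‖z‖ ∧ ‖z‖ < 1 / ε}

/-- The truncated fractional-Laplacian integral
`∫_{ε<|z|<1/ε} (u(x) - u(x+z)) |z|^{-N-2s} dz` (without the normalizing constant). -/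
def pvInt (N : ℕ) (s : ℝ) (u : EuclideanSpace ℝ (Fin N) → ℝ)
    (x : EuclideanSpace ℝ (Fin N)) (ε : ℝ) : ℝ :=
  ∫ z in annulus N ε, (u x - u (x + z)) / ‖z‖ ^ ((N : ℝ) + 2 * s)

/-- `u` is `s`-harmonic at `x` in the principal value sense:
`lim_{ε→0⁺} c_{N,s} ∫_{ε<|z|<1/ε} (u(x) - u(x+z)) |z|^{-N-2s} dz = 0`. -/
def SHarmonicAt (N : ℕ) (s : ℝ) (u : EuclideanSpace ℝ (Fin N) → ℝ)
    (x : EuclideanSpace ℝ (Fin N)) : Prop :=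
  Tendsto (fun ε : ℝ => cns N s * pvInt N s u x ε) (𝓝[>] (0 : ℝ)) (𝓝 0)

/-- `u` is (the evaluation of) a homogeneous polynomial of degree `m` on `ℝ^N`. -/
def IsHomPoly (N m : ℕ) (u : EuclideanSpace ℝ (Fin N) → ℝ) : Prop :=
  ∃ P : MvPolynomial (Fin N) ℝ, P.IsHomogeneous m ∧
    ∀ x : EuclideanSpace ℝ (Fin N), u x = MvPolynomial.eval (fun i => x i) P

/-- The Laplacian of `u` at `x`, as the sum of the pure second directional derivatives. -/
def lap (N : ℕ) (u : EuclideanSpace ℝ (Fin N) → ℝ) (x : EuclideanSpace ℝ (Fin N)) : ℝ :=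
  ∑ i : Fin N, iteratedFDeriv ℝ 2 u x ![EuclideanSpace.single i 1, EuclideanSpace.single i 1]


/-- Evaluation of a real polynomial on Euclidean space. -/
def polyFun {N : ℕ} (P : MvPolynomial (Fin N) ℝ) (x : EuclideanSpace ℝ (Fin N)) : ℝ :=
  MvPolynomial.eval (fun i => x i) P

/-- The Laplacian of a real polynomial. -/
def polyLaplacian {N : ℕ} (P : MvPolynomial (Fin N) ℝ) : MvPolynomial (Fin N) ℝ :=
  ∑ i, MvPolynomial.pderiv i (MvPolynomial.pderiv i P)

section Algebra

open MvPolynomial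

variable {N : ℕ}

lemma polyFun_smul {P : MvPolynomial (Fin N) ℝ} {k : ℕ} (hP : P.IsHomogeneous k) (r : ℝ)
    (x : EuclideanSpace ℝ (Fin N)) : polyFun P (r • x) = r ^ k * polyFun P x := by
  unfold polyFun
  rw [eval_eq, eval_eq, Finset.mul_sum]
  refine Finset.sum_congr rfl fun d hd => ?_
  have hdeg : ∑ i ∈ d.support, d i = k := by
    by_contra h
    exact mem_support_iff.1 hd (hP.coeff_eq_zero h)
  simp only [PiLp.smul_apply, smul_eq_mul, mul_pow, Finset.prod_mul_distrib,
    Finset.prod_pow_eq_pow_sum, hdeg]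
  ring

lemma homogeneousComponent_pderiv (k : ℕ) (i : Fin N) (P : MvPolynomial (Fin N) ℝ) :
    homogeneousComponent k (pderiv i P) = pderiv i (homogeneousComponent (k + 1) P) := by
  ext d
  simp only [coeff_homogeneousComponent, coeff_pderiv, map_add, Finsupp.degree_single,
    Nat.add_right_cancel_iff]
  split_ifs <;> simp

lemma homogeneousComponent_polyLaplacian (k : ℕ) (P : MvPolynomial (Fin N) ℝ) :
    homogeneousComponent k (polyLaplacian P) = polyLaplacian (homogeneousComponent (k + 2) P) := by
  simp only [polyLaplacian, map_sum, homogeneousComponent_pderiv]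

lemma polyLaplacian_homogeneousComponent_one (P : MvPolynomial (Fin N) ℝ) :
    polyLaplacian (homogeneousComponent 1 P) = 0 := by
  refine Finset.sum_eq_zero fun i _ => ?_
  rw [← homogeneousComponent_pderiv 0, homogeneousComponent_zero, pderiv_C]

/-- The polynomial `z ↦ P (x + z)`. -/
def polyTranslate (x : EuclideanSpace ℝ (Fin N)) :
    MvPolynomial (Fin N) ℝ →ₐ[ℝ] MvPolynomial (Fin N) ℝ :=
  aeval fun i => C (x i) + X i

lemma polyFun_polyTranslate (P : MvPolynomial (Fin N) ℝ) (x z : EuclideanSpace ℝ (Fin N)) :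
    polyFun (polyTranslate x P) z = polyFun P (x + z) := by
  unfold polyFun
  induction P using MvPolynomial.induction_on with
  | C a => simp [polyTranslate]
  | add p q hp hq => rw [map_add, map_add, map_add, hp, hq]
  | mul_X p i hp =>
    rw [map_mul, map_mul, map_mul, hp]
    simp [polyTranslate]

lemma pderiv_polyTranslate (P : MvPolynomial (Fin N) ℝ) (x : EuclideanSpace ℝ (Fin N)) (i : Fin N) :
    pderiv i (polyTranslate x P) = polyTranslate x (pderiv i P) := by
  induction P using MvPolynomial.induction_on with
  | C a => simp [polyTranslate]
  | add p q hp hq => rw [map_add, map_add, hp, hq, map_add, map_add]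
  | mul_X p j hp =>
    have hXj : polyTranslate x (X j) = C (x j) + X j := by simp [polyTranslate]
    simp only [map_mul, pderiv_mul, hp, hXj, map_add, pderiv_C, zero_add]
    by_cases h : j = i
    · subst h; simp
    · simp [pderiv_X_of_ne h]

lemma polyLaplacian_polyTranslate (P : MvPolynomial (Fin N) ℝ) (x : EuclideanSpace ℝ (Fin N)) :
    polyLaplacian (polyTranslate x P) = polyTranslate x (polyLaplacian P) := by
  simp only [polyLaplacian, map_sum, pderiv_polyTranslate]

lemma coeff_zero_polyTranslate (P : MvPolynomial (Fin N) ℝ) (x : EuclideanSpace ℝ (Fin N)) :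
    coeff 0 (polyTranslate x P) = polyFun P x := by
  have h := polyFun_polyTranslate P x 0
  rw [add_zero] at h
  rw [← h, polyFun, ← constantCoeff_eq]
  simp [← eval_zero']

lemma eq_zero_of_polyFun_eq_zero {P : MvPolynomial (Fin N) ℝ} (h : ∀ x, polyFun P x = 0) :
    P = 0 :=
  MvPolynomial.funext fun v => by simpa [polyFun] using h (WithLp.toLp 2 v)

end Algebra

section Analysis

open MvPolynomial

variable {N : ℕ}

lemma hasFDerivAt_polyFun (P : MvPolynomial (Fin N) ℝ) (x : EuclideanSpace ℝ (Fin N)) :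
    HasFDerivAt (polyFun P)
      (∑ i, polyFun (pderiv i P) x • (EuclideanSpace.proj i : EuclideanSpace ℝ (Fin N) →L[ℝ] ℝ))
      x := by
  unfold polyFun
  induction P using MvPolynomial.induction_on with
  | C a => simpa using hasFDerivAt_const a x
  | add p q hp hq =>
    simp only [map_add]
    exact (hp.fun_add hq).congr_fderiv (by simp only [add_smul, Finset.sum_add_distrib])
  | mul_X p j hp =>
    have hX : HasFDerivAt (fun y : EuclideanSpace ℝ (Fin N) => y j)
        (EuclideanSpace.proj j : EuclideanSpace ℝ (Fin N) →L[ℝ] ℝ) x :=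
      (EuclideanSpace.proj j : EuclideanSpace ℝ (Fin N) →L[ℝ] ℝ).hasFDerivAt
    simp only [map_mul, eval_X]
    refine (hp.fun_mul hX).congr_fderiv ?_
    simp only [pderiv_mul, map_add, map_mul, eval_X, add_smul, Finset.sum_add_distrib,
      Finset.smul_sum, smul_smul]
    rw [add_comm]
    congr 1
    · exact Finset.sum_congr rfl fun i _ => by rw [mul_comm]
    · rw [Finset.sum_eq_single j]
      · simp
      · intro i _ hij
        simp [pderiv_X_of_ne hij.symm]
      · simp

lemma fderiv_polyFun_single (P : MvPolynomial (Fin N) ℝ) (x : EuclideanSpace ℝ (Fin N))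
    (i : Fin N) : fderiv ℝ (polyFun P) x (EuclideanSpace.single i 1) = polyFun (pderiv i P) x := by
  rw [(hasFDerivAt_polyFun P x).fderiv]
  simp

lemma differentiable_polyFun (P : MvPolynomial (Fin N) ℝ) : Differentiable ℝ (polyFun P) :=
  fun x => (hasFDerivAt_polyFun P x).differentiableAt

lemma continuous_polyFun (P : MvPolynomial (Fin N) ℝ) : Continuous (polyFun P) :=
  (differentiable_polyFun P).continuous

lemma lap_polyFun (P : MvPolynomial (Fin N) ℝ) (x : EuclideanSpace ℝ (Fin N)) :
    lap N (polyFun P) x = polyFun (polyLaplacian P) x := by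
  have hfd : fderiv ℝ (polyFun P) = fun y => ∑ i, polyFun (pderiv i P) y •
      (EuclideanSpace.proj i : EuclideanSpace ℝ (Fin N) →L[ℝ] ℝ) :=
    funext fun y => (hasFDerivAt_polyFun P y).fderiv
  have hsecond : HasFDerivAt (fderiv ℝ (polyFun P))
      (∑ i, (fderiv ℝ (polyFun (pderiv i P)) x).smulRight
        (EuclideanSpace.proj i : EuclideanSpace ℝ (Fin N) →L[ℝ] ℝ)) x := by
    rw [hfd]
    exact HasFDerivAt.fun_sum fun i _ =>
      ((differentiable_polyFun (pderiv i P)) x).hasFDerivAt.smul_const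
        (EuclideanSpace.proj i : EuclideanSpace ℝ (Fin N) →L[ℝ] ℝ)
  have hsum : polyFun (polyLaplacian P) x = ∑ i, polyFun (pderiv i (pderiv i P)) x := by
    simp [polyFun, polyLaplacian]
  rw [hsum, lap]
  refine Finset.sum_congr rfl fun i _ => ?_
  rw [iteratedFDeriv_two_apply, hsecond.fderiv, ← fderiv_polyFun_single (pderiv i P)]
  simp

lemma exists_abs_polyFun_le (P : MvPolynomial (Fin N) ℝ) :
    ∃ (C : ℝ) (n : ℕ), 0 ≤ C ∧ ∀ x, |polyFun P x| ≤ C * exp (n * ‖x‖) := by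
  unfold polyFun
  induction P using MvPolynomial.induction_on with
  | C a => exact ⟨|a|, 0, abs_nonneg _, fun x => by simp⟩
  | add p q hp hq =>
    obtain ⟨C, n, hC, h⟩ := hp
    obtain ⟨D, k, hD, h'⟩ := hq
    refine ⟨C + D, n + k, by positivity, fun x => ?_⟩
    have h1 : exp (n * ‖x‖) ≤ exp ((n + k : ℕ) * ‖x‖) := by
      gcongr; omega
    have h2 : exp (k * ‖x‖) ≤ exp ((n + k : ℕ) * ‖x‖) := by
      gcongr; omega
    rw [map_add, add_mul]
    exact (abs_add_le _ _).trans (add_le_add ((h x).trans (by gcongr)) ((h' x).trans (by gcongr)))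
  | mul_X p j hp =>
    obtain ⟨C, n, hC, h⟩ := hp
    refine ⟨C, n + 1, hC, fun x => ?_⟩
    have hx : |x j| ≤ exp ‖x‖ := by
      have h1 : ‖x j‖ ≤ ‖x‖ := PiLp.norm_apply_le x j
      have h2 := add_one_le_exp ‖x‖
      rw [Real.norm_eq_abs] at h1
      linarith
    rw [map_mul, eval_X, abs_mul]
    calc |eval (fun i => x i) p| * |x j| ≤ (C * exp (n * ‖x‖)) * exp ‖x‖ := by
          gcongr
          exact h x
      _ = C * exp ((n + 1 : ℕ) * ‖x‖) := by
          rw [mul_assoc, ← exp_add]; push_cast; ring_nf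

lemma integrable_polyFun_mul_gaussian (P : MvPolynomial (Fin N) ℝ) :
    Integrable (fun x => polyFun P x * exp (-‖x‖ ^ 2 / 2)) := by
  obtain ⟨C, n, hC, h⟩ := exists_abs_polyFun_le P
  have hg : Integrable fun x : EuclideanSpace ℝ (Fin N) => exp (-(1 / 4) * ‖x‖ ^ 2) := by
    have := (GaussianFourier.integrable_cexp_neg_mul_sq_norm_add (b := (1 / 4 : ℂ)) (by norm_num)
      0 (0 : EuclideanSpace ℝ (Fin N))).norm
    refine this.congr (Eventually.of_forall fun x => ?_)
    simp only [inner_zero_left, Complex.norm_exp]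
    norm_num
    norm_cast
  refine (hg.const_mul (C * exp (n ^ 2 : ℝ))).mono'
    (((continuous_polyFun P).mul (by fun_prop)).aestronglyMeasurable)
    (Eventually.of_forall fun x => ?_)
  rw [norm_mul, Real.norm_eq_abs, Real.norm_eq_abs, abs_exp]
  calc |polyFun P x| * exp (-‖x‖ ^ 2 / 2) ≤ C * exp (n * ‖x‖) * exp (-‖x‖ ^ 2 / 2) := by
        gcongr
        exact h x
    _ = C * exp (n * ‖x‖ + -‖x‖ ^ 2 / 2) := by rw [exp_add]; ring
    _ ≤ C * exp (n ^ 2 + -(1 / 4) * ‖x‖ ^ 2) := by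
        refine mul_le_mul_of_nonneg_left (exp_le_exp.2 ?_) hC
        nlinarith [sq_nonneg ((n : ℝ) - ‖x‖ / 2)]
    _ = _ := by rw [exp_add]; ring

/-- Gaussian moments of a homogeneous polynomial are governed by those of its Laplacian. -/
lemma natCast_mul_integral_gaussian {P : MvPolynomial (Fin N) ℝ} {k : ℕ}
    (hP : P.IsHomogeneous k) :
    k * ∫ x, polyFun P x * exp (-‖x‖ ^ 2 / 2) =
      ∫ x, polyFun (polyLaplacian P) x * exp (-‖x‖ ^ 2 / 2) := by
  have hgauss (x : EuclideanSpace ℝ (Fin N)) :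
      HasFDerivAt (fun y : EuclideanSpace ℝ (Fin N) => exp (-‖y‖ ^ 2 / 2))
        (exp (-‖x‖ ^ 2 / 2) • -innerSL ℝ x) x := by
    have h1 : HasFDerivAt (fun y : EuclideanSpace ℝ (Fin N) => ‖y‖ ^ 2) (2 • innerSL ℝ x) x :=
      (hasStrictFDerivAt_norm_sq x).hasFDerivAt
    have h2 : HasFDerivAt (fun y : EuclideanSpace ℝ (Fin N) => -‖y‖ ^ 2 / 2)
        (-innerSL ℝ x) x := by
      refine ((h1.const_mul (-1 / 2 : ℝ)).congr_fderiv ?_).congr_of_eventuallyEq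
        (Eventually.of_forall fun y => by ring)
      ext y
      simp
      ring
    exact h2.exp
  have hgauss' (x : EuclideanSpace ℝ (Fin N)) (i : Fin N) :
      fderiv ℝ (fun y : EuclideanSpace ℝ (Fin N) => exp (-‖y‖ ^ 2 / 2)) x
        (EuclideanSpace.single i 1) = -(x i * exp (-‖x‖ ^ 2 / 2)) := by
    rw [(hgauss x).fderiv]
    simp [EuclideanSpace.inner_single_right, mul_comm]
  have hparts (i : Fin N) : ∫ x, polyFun (X i * pderiv i P) x * exp (-‖x‖ ^ 2 / 2) =
      ∫ x, polyFun (pderiv i (pderiv i P)) x * exp (-‖x‖ ^ 2 / 2) := by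
    have hX (x : EuclideanSpace ℝ (Fin N)) :
        polyFun (X i * pderiv i P) x = x i * polyFun (pderiv i P) x := by simp [polyFun]
    have key := integral_mul_fderiv_eq_neg_fderiv_mul_of_integrable
      (μ := (volume : Measure (EuclideanSpace ℝ (Fin N))))
      (f := polyFun (pderiv i P)) (g := fun y => exp (-‖y‖ ^ 2 / 2))
      (v := EuclideanSpace.single i 1)
      (by simpa only [fderiv_polyFun_single] using integrable_polyFun_mul_gaussian _)
      (by
        simp only [hgauss']
        refine (integrable_polyFun_mul_gaussian (X i * pderiv i P)).neg.congr
          (Eventually.of_forall fun x => ?_)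
        simp only [Pi.neg_apply, hX]
        ring)
      (integrable_polyFun_mul_gaussian _)
      (fun x _ => differentiable_polyFun _ x) (fun x _ => (hgauss x).differentiableAt)
    simp only [fderiv_polyFun_single, hgauss'] at key
    rw [← neg_inj, ← key, ← integral_neg]
    refine integral_congr_ae (Eventually.of_forall fun x => ?_)
    simp only [hX]
    ring
  have hsum1 (x : EuclideanSpace ℝ (Fin N)) :
      (k : ℝ) * polyFun P x = ∑ i, polyFun (X i * pderiv i P) x := by
    have := congrArg (polyFun · x) hP.sum_X_mul_pderiv
    simpa [polyFun] using this.symm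
  have hsum2 (x : EuclideanSpace ℝ (Fin N)) :
      polyFun (polyLaplacian P) x = ∑ i, polyFun (pderiv i (pderiv i P)) x := by
    simp [polyFun, polyLaplacian]
  rw [← integral_const_mul]
  simp only [← mul_assoc, hsum1, hsum2, Finset.sum_mul]
  rw [integral_finsetSum _ fun i _ => integrable_polyFun_mul_gaussian _,
    integral_finsetSum _ fun i _ => integrable_polyFun_mul_gaussian _]
  exact Finset.sum_congr rfl fun i _ => hparts i

end Analysis

section Polar

open Metric Module

variable {E : Type*} [NormedAddCommGroup E] [NormedSpace ℝ E] [FiniteDimensional ℝ E]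
  [MeasurableSpace E] [BorelSpace E] [Nontrivial E]

/-- Polar coordinates for the product of a positively homogeneous function and a radial one. -/
lemma integral_homogeneous_mul_radial (μ : Measure E) [μ.IsAddHaarMeasure] {f : E → ℝ} {k : ℕ}
    (hf : ∀ (r : ℝ) (x : E), f (r • x) = r ^ k * f x) (w : ℝ → ℝ) :
    ∫ x, f x * w ‖x‖ ∂μ = (∫ y : sphere (0 : E) 1, f y ∂μ.toSphere) *
      ∫ r in Ioi (0 : ℝ), r ^ (finrank ℝ E - 1) * (r ^ k * w r) :=
  calc
    ∫ x, f x * w ‖x‖ ∂μ = ∫ x : ({(0)}ᶜ : Set E), f x * w ‖x.1‖ ∂(μ.comap (↑)) := by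
      rw [integral_subtype_comap (measurableSet_singleton _).compl fun x ↦ f x * w ‖x‖,
        restrict_compl_singleton]
    _ = ∫ p, f p.1 * ((p.2 : ℝ) ^ k * w p.2)
          ∂μ.toSphere.prod (.volumeIoiPow (finrank ℝ E - 1)) := by
      rw [← μ.measurePreserving_homeomorphUnitSphereProd.integral_comp
        (Homeomorph.measurableEmbedding _)]
      refine integral_congr_ae (Eventually.of_forall fun x => ?_)
      have hx : ‖(x : E)‖ ≠ 0 := norm_ne_zero_iff.2 x.2
      simp only [homeomorphUnitSphereProd_apply_fst_coe, homeomorphUnitSphereProd_apply_snd_coe]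
      rw [hf, inv_pow]
      field_simp
    _ = (∫ y : sphere (0 : E) 1, f y ∂μ.toSphere) *
          ∫ r : Ioi (0 : ℝ), (r : ℝ) ^ k * w r ∂.volumeIoiPow (finrank ℝ E - 1) :=
      integral_prod_mul (fun y : sphere (0 : E) 1 => f y)
        (fun r : Ioi (0 : ℝ) => (r : ℝ) ^ k * w r)
    _ = _ := by
      congr 1
      simp only [Measure.volumeIoiPow, ENNReal.ofReal]
      rw [integral_withDensity_eq_integral_smul,
        integral_subtype_comap measurableSet_Ioi
          fun a ↦ Real.toNNReal (a ^ (finrank ℝ E - 1)) • (a ^ k * w a),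
        setIntegral_congr_fun measurableSet_Ioi fun x hx ↦ ?_]
      · rw [NNReal.smul_def, Real.coe_toNNReal _ (pow_nonneg hx.out.le _), smul_eq_mul]
      · exact (measurable_subtype_coe.pow_const _).real_toNNReal

end Polar

section SphereIntegral

open MvPolynomial

variable {N : ℕ}

/-- The integral of a polynomial over the unit sphere. -/
def sphereIntegral (P : MvPolynomial (Fin N) ℝ) : ℝ :=
  ∫ y : Metric.sphere (0 : EuclideanSpace ℝ (Fin N)) 1, polyFun P y ∂volume.toSphere

lemma integral_polyFun_mul_radial [NeZero N] {P : MvPolynomial (Fin N) ℝ} {k : ℕ}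
    (hP : P.IsHomogeneous k) (w : ℝ → ℝ) :
    ∫ x, polyFun P x * w ‖x‖ =
      sphereIntegral P * ∫ r in Ioi (0 : ℝ), r ^ (N - 1) * (r ^ k * w r) := by
  rw [integral_homogeneous_mul_radial volume (polyFun_smul hP) w, finrank_euclideanSpace_fin]
  rfl

lemma sphereIntegral_eq_zero_iff [NeZero N] {P : MvPolynomial (Fin N) ℝ} {k : ℕ}
    (hP : P.IsHomogeneous k) :
    sphereIntegral P = 0 ↔ ∫ x, polyFun P x * exp (-‖x‖ ^ 2 / 2) = 0 := by
  have hpos : 0 < ∫ r in Ioi (0 : ℝ), r ^ (N - 1) * (r ^ k * exp (-r ^ 2 / 2)) := by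
    have h := integral_rpow_mul_exp_neg_mul_rpow (p := 2) (q := ((N - 1 + k : ℕ) : ℝ))
      (b := 1 / 2) (by norm_num) (by have := Nat.cast_nonneg (α := ℝ) (N - 1 + k); linarith)
      (by norm_num)
    have heq : ∫ r in Ioi (0 : ℝ), r ^ (N - 1) * (r ^ k * exp (-r ^ 2 / 2)) =
        ∫ r in Ioi (0 : ℝ), r ^ ((N - 1 + k : ℕ) : ℝ) * exp (-(1 / 2) * r ^ (2 : ℝ)) := by
      refine setIntegral_congr_fun measurableSet_Ioi fun r _ => ?_
      simp only [rpow_natCast, rpow_two, pow_add]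
      ring_nf
    rw [heq, h]
    have : 0 < Gamma ((((N - 1 + k : ℕ) : ℝ) + 1) / 2) := Gamma_pos_of_pos (by positivity)
    positivity
  rw [integral_polyFun_mul_radial hP fun r => exp (-r ^ 2 / 2), mul_eq_zero, or_iff_left hpos.ne']

lemma sphereIntegral_eq_zero_of_polyLaplacian_eq_zero [NeZero N] {P : MvPolynomial (Fin N) ℝ}
    {k : ℕ} (hP : P.IsHomogeneous k) (hk : k ≠ 0) (h : polyLaplacian P = 0) :
    sphereIntegral P = 0 := by
  rw [sphereIntegral_eq_zero_iff hP]
  have := natCast_mul_integral_gaussian hP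
  simpa [h, hk, polyFun] using this

lemma coeff_zero_polyLaplacian_eq_zero [NeZero N] {P : MvPolynomial (Fin N) ℝ}
    (h : sphereIntegral (homogeneousComponent 2 P) = 0) : coeff 0 (polyLaplacian P) = 0 := by
  have hhom := homogeneousComponent_isHomogeneous 2 P
  rw [sphereIntegral_eq_zero_iff hhom] at h
  have key := natCast_mul_integral_gaussian hhom
  rw [h, mul_zero, ← homogeneousComponent_polyLaplacian 0, homogeneousComponent_zero] at key
  have hpos : 0 < ∫ x : EuclideanSpace ℝ (Fin N), exp (-‖x‖ ^ 2 / 2) :=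
    integral_exp_pos (by simpa [polyFun] using integrable_polyFun_mul_gaussian (N := N) (C 1))
  simp only [polyFun, eval_C, integral_const_mul] at key
  exact (mul_eq_zero.1 key.symm).resolve_right hpos.ne'

end SphereIntegral

section Annulus

open MvPolynomial

variable {N : ℕ}

/-- The radial weight of the truncated fractional Laplacian. -/
def annulusWeight (N : ℕ) (s ε : ℝ) : ℝ → ℝ :=
  (Ioo ε (1 / ε)).indicator fun r => (r ^ ((N : ℝ) + 2 * s))⁻¹

lemma measurableSet_annulus (N : ℕ) (ε : ℝ) : MeasurableSet (annulus N ε) :=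
  measurable_norm measurableSet_Ioo

lemma indicator_annulus_div (s ε : ℝ) (f : EuclideanSpace ℝ (Fin N) → ℝ) :
    (annulus N ε).indicator (fun z => f z / ‖z‖ ^ ((N : ℝ) + 2 * s)) =
      fun z => f z * annulusWeight N s ε ‖z‖ := by
  ext z
  by_cases hz : ‖z‖ ∈ Ioo ε (1 / ε)
  · rw [indicator_of_mem (show z ∈ annulus N ε from hz), annulusWeight, indicator_of_mem hz,
      div_eq_mul_inv]
  · rw [indicator_of_notMem (show z ∉ annulus N ε from hz), annulusWeight,
      indicator_of_notMem hz, mul_zero]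

lemma integrable_polyFun_mul_annulusWeight (s : ℝ) {ε : ℝ} (hε : 0 < ε)
    (P : MvPolynomial (Fin N) ℝ) :
    Integrable fun z => polyFun P z * annulusWeight N s ε ‖z‖ := by
  rw [← indicator_annulus_div, integrable_indicator_iff (measurableSet_annulus N ε)]
  have hsub : annulus N ε ⊆ Metric.closedBall 0 (1 / ε) ∩ {z | ε ≤ ‖z‖} :=
    fun z hz => ⟨by simpa using hz.2.le, hz.1.le⟩
  refine IntegrableOn.mono_set (ContinuousOn.integrableOn_compact ?_ ?_) hsub
  · exact (isCompact_closedBall _ _).inter_right (isClosed_le continuous_const continuous_norm)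
  · refine (continuous_polyFun P).continuousOn.div ?_ fun z hz => ?_
    · exact continuous_norm.continuousOn.rpow_const fun z hz =>
        Or.inl (hε.trans_le hz.2).ne'
    · exact (rpow_pos_of_pos (hε.trans_le hz.2) _).ne'

lemma integral_radial_annulusWeight [NeZero N] {s : ℝ} (hs : s < 1) {ε : ℝ} (hε : 0 < ε)
    (hε1 : ε < 1) (k : ℕ) :
    ∫ r in Ioi (0 : ℝ), r ^ (N - 1) * (r ^ (k + 2) * annulusWeight N s ε r) =
      ((1 / ε) ^ ((k : ℝ) + 2 - 2 * s) - ε ^ ((k : ℝ) + 2 - 2 * s)) / (k + 2 - 2 * s) := by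
  have hk : (0 : ℝ) ≤ k := Nat.cast_nonneg k
  have hle : ε ≤ 1 / ε := by rw [le_div_iff₀ hε]; nlinarith
  have hsub : Ioo ε (1 / ε) ⊆ Ioi 0 := fun r hr => hε.trans hr.1
  have hN : ((N - 1 : ℕ) : ℝ) = N - 1 := by
    rw [Nat.cast_sub (NeZero.one_le), Nat.cast_one]
  have hfun : ∀ r ∈ Ioi (0 : ℝ), r ^ (N - 1) * (r ^ (k + 2) * annulusWeight N s ε r) =
      (Ioo ε (1 / ε)).indicator (fun r => r ^ ((k : ℝ) + 1 - 2 * s)) r := by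
    intro r hr
    have hr : 0 < r := hr
    by_cases h : r ∈ Ioo ε (1 / ε)
    · rw [annulusWeight, indicator_of_mem h, indicator_of_mem h, ← rpow_natCast, ← rpow_natCast,
        ← rpow_neg hr.le, ← rpow_add hr, ← rpow_add hr, hN]
      congr 1
      push_cast
      ring
    · rw [annulusWeight, indicator_of_notMem h, indicator_of_notMem h, mul_zero, mul_zero]
  rw [setIntegral_congr_fun measurableSet_Ioi hfun, setIntegral_indicator measurableSet_Ioo,
    inter_eq_right.2 hsub, ← integral_Ioc_eq_integral_Ioo,
    ← intervalIntegral.integral_of_le hle, integral_rpow (Or.inl (by linarith))]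
  ring_nf

lemma polyFun_eq_sum_homogeneousComponent (P : MvPolynomial (Fin N) ℝ)
    (z : EuclideanSpace ℝ (Fin N)) :
    polyFun P z = (∑ k ∈ Finset.range (P.totalDegree + 1),
      polyFun (homogeneousComponent (k + 2) P) z) + polyFun (homogeneousComponent 1 P) z +
        coeff 0 P := by
  have h : ∑ k ∈ Finset.range (P.totalDegree + 1 + 2), homogeneousComponent k P = P := by
    rw [Finset.sum_range_succ, Finset.sum_range_succ, sum_homogeneousComponent,
      homogeneousComponent_eq_zero _ _ (by omega), homogeneousComponent_eq_zero _ _ (by omega),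
      add_zero, add_zero]
  rw [Finset.sum_range_succ', Finset.sum_range_succ', homogeneousComponent_zero] at h
  conv_lhs => rw [← h]
  simp [polyFun]

/-- Closed form of the truncated fractional Laplacian of a polynomial. -/
lemma pvInt_polyFun [NeZero N] {s : ℝ} (hs : s < 1) {ε : ℝ} (hε : 0 < ε) (hε1 : ε < 1)
    (P : MvPolynomial (Fin N) ℝ) (x : EuclideanSpace ℝ (Fin N)) :
    pvInt N s (polyFun P) x ε =
      -∑ k ∈ Finset.range ((polyTranslate x P).totalDegree + 1),
        sphereIntegral (homogeneousComponent (k + 2) (polyTranslate x P)) *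
          (((1 / ε) ^ ((k : ℝ) + 2 - 2 * s) - ε ^ ((k : ℝ) + 2 - 2 * s)) / (k + 2 - 2 * s)) := by
  set T := polyTranslate x P
  have hlinear : sphereIntegral (homogeneousComponent 1 T) = 0 :=
    sphereIntegral_eq_zero_of_polyLaplacian_eq_zero (homogeneousComponent_isHomogeneous 1 T)
      one_ne_zero (polyLaplacian_homogeneousComponent_one T)
  have hdiff (z : EuclideanSpace ℝ (Fin N)) :
      (polyFun P x - polyFun P (x + z)) * annulusWeight N s ε ‖z‖ =
        -(polyFun (homogeneousComponent 1 T) z * annulusWeight N s ε ‖z‖ +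
          ∑ k ∈ Finset.range (T.totalDegree + 1),
            polyFun (homogeneousComponent (k + 2) T) z * annulusWeight N s ε ‖z‖) := by
    rw [← polyFun_polyTranslate, polyFun_eq_sum_homogeneousComponent (polyTranslate x P),
      ← coeff_zero_polyTranslate P x, ← Finset.sum_mul]
    ring
  rw [pvInt, ← integral_indicator (measurableSet_annulus N ε),
    indicator_annulus_div s ε fun z => polyFun P x - polyFun P (x + z)]
  simp only [hdiff]
  rw [integral_neg, integral_add (integrable_polyFun_mul_annulusWeight s hε _)
      (integrable_finsetSum _ fun k _ => integrable_polyFun_mul_annulusWeight s hε _),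
    integral_finsetSum _ fun k _ => integrable_polyFun_mul_annulusWeight s hε _,
    integral_polyFun_mul_radial (homogeneousComponent_isHomogeneous 1 T), hlinear, zero_mul,
    zero_add]
  congr 1
  refine Finset.sum_congr rfl fun k _ => ?_
  rw [integral_polyFun_mul_radial (homogeneousComponent_isHomogeneous (k + 2) T),
    integral_radial_annulusWeight hs hε hε1]

end Annulus

/-- If a finite combination of distinct blowing-up powers tends to zero at zero, its lowest
coefficient vanishes. -/
lemma eq_zero_of_tendsto_sum_rpow {s : ℝ} (hs : s < 1) (n : ℕ) (b : ℕ → ℝ)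
    (h : Tendsto (fun ε : ℝ => ∑ k ∈ Finset.range (n + 1),
      b k * ((1 / ε) ^ ((k : ℝ) + 2 - 2 * s) - ε ^ ((k : ℝ) + 2 - 2 * s)))
      (𝓝[>] 0) (𝓝 0)) : b 0 = 0 := by
  have hpow {a : ℝ} (ha : 0 < a) : Tendsto (fun ε : ℝ => ε ^ a) (𝓝[>] 0) (𝓝 0) := by
    have := (continuousAt_rpow_const 0 a (Or.inr ha.le)).tendsto
    rw [zero_rpow ha.ne'] at this
    exact this.mono_left nhdsWithin_le_nhds
  have hsmall : Tendsto (fun ε : ℝ => ∑ k ∈ Finset.range (n + 1),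
      b k * ε ^ ((k : ℝ) + 2 - 2 * s)) (𝓝[>] 0) (𝓝 0) := by
    have := tendsto_finsetSum (Finset.range (n + 1)) fun k _ =>
      (hpow (a := (k : ℝ) + 2 - 2 * s)
        (by have := Nat.cast_nonneg (α := ℝ) k; linarith)).const_mul (b k)
    simpa using this
  have hprod := (hpow (a := 2 - 2 * s) (by linarith)).mul (h.add hsmall)
  rw [add_zero, mul_zero] at hprod
  have hinv := hprod.comp tendsto_inv_atTop_nhdsGT_zero
  let q : Polynomial ℝ := ∑ k ∈ Finset.range (n + 1), Polynomial.C (b k) * Polynomial.X ^ k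
  have hq : Tendsto (fun t => q.eval t) atTop (𝓝 0) := by
    refine hinv.congr' ?_
    filter_upwards [eventually_gt_atTop 0] with t ht
    simp only [Function.comp_apply, ← Finset.sum_add_distrib, q, Polynomial.eval_finsetSum,
      Polynomial.eval_mul, Polynomial.eval_C, Polynomial.eval_pow, Polynomial.eval_X,
      Finset.mul_sum]
    refine Finset.sum_congr rfl fun k _ => ?_
    have h1 : t ^ ((k : ℝ) + 2 - 2 * s) = t ^ k * t ^ (2 - 2 * s) := by
      rw [add_sub_assoc, rpow_add ht, rpow_natCast]
    have h2 : t ^ (2 - 2 * s) ≠ 0 := (rpow_pos_of_pos ht _).ne'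
    rw [one_div, inv_inv, inv_rpow ht.le, ← mul_add, sub_add_cancel, h1]
    field_simp
  have hq0 : q = 0 := Polynomial.leadingCoeff_eq_zero.1 ((Polynomial.tendsto_nhds_iff q).1 hq).1
  have hcoeff : q.coeff 0 = b 0 := by
    simp [q, Polynomial.coeff_X_pow]
  rw [← hcoeff, hq0, Polynomial.coeff_zero]

lemma cns_ne_zero (N : ℕ) {s : ℝ} (hs : s ∈ Ioo (0 : ℝ) 1) : cns N s ≠ 0 := by
  have h0 := hs.1
  have h1 : 0 < Gamma (1 - s) := Gamma_pos_of_pos (sub_pos.2 hs.2)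
  have h2 : 0 < Gamma (((N : ℝ) + 2 * s) / 2) := Gamma_pos_of_pos (by positivity)
  have : 0 < cns N s := by unfold cns; positivity
  exact this.ne'

/-- A homogeneous polynomial of degree `m` on `ℝ^N` (`N ≥ 2`, `s ∈ (0,1)`) is `s`-harmonic
at every point (in the principal value sense) if and only if it is harmonic. -/
theorem homogeneous_sHarmonic_iff_harmonic
    (N : ℕ) (hN : 2 ≤ N) (s : ℝ) (hs : s ∈ Ioo (0 : ℝ) 1) (m : ℕ)
    (u : EuclideanSpace ℝ (Fin N) → ℝ) (hu : IsHomPoly N m u) :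
    (∀ x, SHarmonicAt N s u x) ↔ (∀ x, lap N u x = 0) := by
  obtain ⟨P, -, hP⟩ := hu
  obtain rfl : u = polyFun P := funext hP
  have : NeZero N := ⟨by omega⟩
  have hsmall : ∀ᶠ ε : ℝ in 𝓝[>] 0, ε ∈ Ioo (0 : ℝ) 1 := Ioo_mem_nhdsGT one_pos
  simp only [lap_polyFun]
  constructor
  · intro h x
    rw [← coeff_zero_polyTranslate, ← polyLaplacian_polyTranslate]
    refine coeff_zero_polyLaplacian_eq_zero ?_
    have hlim := (h x).const_mul (-(cns N s)⁻¹)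
    rw [mul_zero] at hlim
    have hb := eq_zero_of_tendsto_sum_rpow hs.2 (polyTranslate x P).totalDegree
      (fun k => sphereIntegral (MvPolynomial.homogeneousComponent (k + 2) (polyTranslate x P)) /
        (k + 2 - 2 * s)) <| hlim.congr' <| by
      filter_upwards [hsmall] with ε hε
      rw [← mul_assoc, neg_mul, inv_mul_cancel₀ (cns_ne_zero N hs), neg_one_mul,
        pvInt_polyFun hs.2 hε.1 hε.2, neg_neg]
      exact Finset.sum_congr rfl fun k _ => by ring
    have hden : (2 : ℝ) - 2 * s ≠ 0 := by linarith [hs.2]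
    simpa [hden] using hb
  · intro h x
    have hT : polyLaplacian (polyTranslate x P) = 0 := by
      rw [polyLaplacian_polyTranslate, eq_zero_of_polyFun_eq_zero h, map_zero]
    refine tendsto_const_nhds.congr' ?_
    filter_upwards [hsmall] with ε hε
    rw [pvInt_polyFun hs.2 hε.1 hε.2, Finset.sum_eq_zero, neg_zero, mul_zero]
    intro k _
    rw [sphereIntegral_eq_zero_of_polyLaplacian_eq_zero
      (MvPolynomial.homogeneousComponent_isHomogeneous (k + 2) _) (by omega)
      (by rw [← homogeneousComponent_polyLaplacian, hT, map_zero]), zero_mul]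
end
end

section
/- Let N ≥ 2 and s ∈ (0,1). If h : ℝ^N → ℝ is harmonic on all of ℝ^N (Δh = 0 everywhere), then h is s-harmonic on ℝ^N in the principal value sense: for every x ∈ ℝ^N and every ε ∈ (0,1), ∫_{{z : ε < |z| < 1/ε}} (h(x) − h(x+z)) |z|^{−N−2s} dz = 0, and consequently lim_{ε→0^+} c_{N,s} ∫_{{z : ε < |z| < 1/ε}} (h(x) − h(x+z)) |z|^{−N−2s} dz = 0. -/
open MeasureTheory Real Filter Set Topology

noncomputable section

theorem hasCompactSupport_of_norm_sq {E : Type*} [NormedAddCommGroup E] [ProperSpace E]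
    {f : E → ℝ} {T : ℝ} (hf : ∀ z, T ≤ ‖z‖ ^ 2 → f z = 0) : HasCompactSupport f := by
  refine HasCompactSupport.intro (isCompact_closedBall (0 : E) (|T| + 1)) fun z hz => hf z ?_
  rw [mem_closedBall_zero_iff, not_le] at hz
  nlinarith [abs_nonneg T, le_abs_self T]

/-- The divergence identity behind the mean value property: the radial derivative of a harmonic
function, tested against a radial weight, integrates to zero. -/
theorem integral_radial_mul_fderiv_eq_zero {N : ℕ} {h : EuclideanSpace ℝ (Fin N) → ℝ}
    (hreg : ContDiff ℝ 2 h) (hharm : ∀ x, lap N h x = 0) {k : ℝ → ℝ} (hk : Continuous k)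
    {T : ℝ} (hT : ∀ t, T ≤ t → k t = 0) (x : EuclideanSpace ℝ (Fin N)) (r : ℝ) :
    ∫ z, k (‖z‖ ^ 2) * fderiv ℝ h (x + r • z) z = 0 := by
  set e : Fin N → EuclideanSpace ℝ (Fin N) := fun i => EuclideanSpace.single i 1 with he
  set K : ℝ → ℝ := fun t => ∫ u in T..t, k u with hK
  have hKd : ∀ t, HasDerivAt K (k t) t := fun t => (hk.integral_hasStrictDerivAt T t).hasDerivAt
  have hKc : Continuous K := continuous_iff_continuousAt.2 fun t => (hKd t).continuousAt
  have hKT : ∀ t, T ≤ t → K t = 0 := fun t ht => by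
    rw [hK]
    refine (intervalIntegral.integral_congr (g := fun _ => (0 : ℝ)) fun u hu => ?_).trans (by simp)
    rw [uIcc_of_le ht] at hu
    exact hT u hu.1
  set Ψ : EuclideanSpace ℝ (Fin N) → ℝ := fun z => K (‖z‖ ^ 2) with hΨ
  have hΨc : Continuous Ψ := by fun_prop
  have hΨd : ∀ z, HasFDerivAt Ψ (k (‖z‖ ^ 2) • (2 : ℝ) • innerSL ℝ z) z := fun z => by
    rw [ofNat_smul_eq_nsmul]
    exact (hKd (‖z‖ ^ 2)).comp_hasFDerivAt z (hasStrictFDerivAt_norm_sq z).hasFDerivAt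
  have hΨe : ∀ z i, fderiv ℝ Ψ z (e i) = 2 * (k (‖z‖ ^ 2) * z i) := fun z i => by
    rw [(hΨd z).fderiv]
    simp [he, EuclideanSpace.inner_single_right]
    ring
  have hf1 : ContDiff ℝ 1 (fderiv ℝ h) := hreg.fderiv_right (by norm_num)
  have hf1c : Continuous (fderiv ℝ h) := hf1.continuous
  have hf2c : Continuous (fderiv ℝ (fderiv ℝ h)) := hf1.continuous_fderiv (by norm_num)
  have hgd : ∀ i z, HasFDerivAt (fun z => fderiv ℝ h (x + r • z) (e i))
      (r • (fderiv ℝ (fderiv ℝ h) (x + r • z)).flip (e i)) z := fun i z => by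
    have h1 : HasFDerivAt (fun z : EuclideanSpace ℝ (Fin N) => x + r • z)
        (r • ContinuousLinearMap.id ℝ (EuclideanSpace ℝ (Fin N))) z :=
      ((hasFDerivAt_id z).const_smul r).const_add x
    have h2 := ((hf1.differentiable (by norm_num) (x + r • z)).hasFDerivAt.comp z h1).clm_apply
      (hasFDerivAt_const (e i) z)
    refine h2.congr_fderiv ?_
    ext v
    simp
  have hge : ∀ i z, fderiv ℝ (fun z => fderiv ℝ h (x + r • z) (e i)) z (e i) =
      r * fderiv ℝ (fderiv ℝ h) (x + r • z) (e i) (e i) := fun i z => by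
    rw [(hgd i z).fderiv]; simp
  have int_k : ∀ {g : EuclideanSpace ℝ (Fin N) → ℝ}, Continuous g →
      Integrable (fun z => k (‖z‖ ^ 2) * g z) := fun {g} hg =>
    Continuous.integrable_of_hasCompactSupport (by fun_prop)
      (hasCompactSupport_of_norm_sq (T := T) fun z hz => by rw [hT _ hz, zero_mul])
  have int_Ψ : ∀ {g : EuclideanSpace ℝ (Fin N) → ℝ}, Continuous g →
      Integrable (fun z => Ψ z * g z) := fun {g} hg =>
    Continuous.integrable_of_hasCompactSupport (by fun_prop)
      (hasCompactSupport_of_norm_sq (T := T) fun z hz => by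
        rw [show Ψ z = 0 from hKT _ hz, zero_mul])
  have parts : ∀ i, ∫ z, k (‖z‖ ^ 2) * (z i * fderiv ℝ h (x + r • z) (e i)) =
      -(r / 2) * ∫ z, Ψ z * fderiv ℝ (fderiv ℝ h) (x + r • z) (e i) (e i) := fun i => by
    have key := integral_mul_fderiv_eq_neg_fderiv_mul_of_integrable
      (μ := (volume : Measure (EuclideanSpace ℝ (Fin N))))
      (f := Ψ) (g := fun z => fderiv ℝ h (x + r • z) (e i)) (v := e i)
      (by
        refine ((int_k (g := fun z => z i * fderiv ℝ h (x + r • z) (e i))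
          (by fun_prop)).const_mul 2).congr (ae_of_all _ fun z => ?_)
        simp only [hΨe]; ring)
      (by simp only [hge]; exact int_Ψ (by fun_prop))
      (int_Ψ (by fun_prop))
      (fun z _ => (hΨd z).differentiableAt) (fun z _ => (hgd i z).differentiableAt)
    simp only [hge, hΨe] at key
    have l : ∫ z, Ψ z * (r * fderiv ℝ (fderiv ℝ h) (x + r • z) (e i) (e i)) =
        r * ∫ z, Ψ z * fderiv ℝ (fderiv ℝ h) (x + r • z) (e i) (e i) := by
      rw [← integral_const_mul]; congr 1; ext z; ring
    have l' : ∫ z, 2 * (k (‖z‖ ^ 2) * z i) * fderiv ℝ h (x + r • z) (e i) =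
        2 * ∫ z, k (‖z‖ ^ 2) * (z i * fderiv ℝ h (x + r • z) (e i)) := by
      rw [← integral_const_mul]; congr 1; ext z; ring
    rw [l, l'] at key
    linarith
  have expand : ∀ z, fderiv ℝ h (x + r • z) z = ∑ i, z i * fderiv ℝ h (x + r • z) (e i) := by
    intro z
    have hz : z = ∑ i, z i • e i := by
      simpa [he] using ((EuclideanSpace.basisFun (Fin N) ℝ).sum_repr z).symm
    conv_lhs => enter [2]; rw [hz]
    simp
  have hlap : ∀ y, ∑ i, fderiv ℝ (fderiv ℝ h) y (e i) (e i) = 0 := fun y => by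
    simpa [lap, iteratedFDeriv_two_apply] using hharm y
  simp only [expand, Finset.mul_sum]
  rw [integral_finsetSum _ fun i _ => int_k (by fun_prop)]
  simp only [parts]
  rw [← Finset.mul_sum, ← integral_finsetSum _ fun i _ => int_Ψ (by fun_prop)]
  simp [← Finset.mul_sum, hlap]

/-- Mean value property of harmonic functions against continuous compactly supported radial
weights. -/
theorem integral_radial_mul_sub_eq_zero {N : ℕ} {h : EuclideanSpace ℝ (Fin N) → ℝ}
    (hreg : ContDiff ℝ 2 h) (hharm : ∀ x, lap N h x = 0) {k : ℝ → ℝ} (hk : Continuous k)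
    {T : ℝ} (hT : ∀ t, T ≤ t → k t = 0) (x : EuclideanSpace ℝ (Fin N)) :
    ∫ z, k (‖z‖ ^ 2) * (h x - h (x + z)) = 0 := by
  have hc : Continuous h := hreg.continuous
  have hf1c : Continuous (fderiv ℝ h) := hreg.continuous_fderiv (by norm_num)
  have int_k : ∀ {g : EuclideanSpace ℝ (Fin N) → ℝ}, Continuous g →
      Integrable (fun z => k (‖z‖ ^ 2) * g z) := fun {g} hg =>
    Continuous.integrable_of_hasCompactSupport (by fun_prop)
      (hasCompactSupport_of_norm_sq (T := T) fun z hz => by rw [hT _ hz, zero_mul])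
  have hd : ∀ r : ℝ, HasDerivAt (fun r : ℝ => ∫ z, k (‖z‖ ^ 2) * h (x + r • z)) 0 r := by
    intro r
    obtain ⟨C, hC⟩ := ((isCompact_closedBall r 1).prod
      (isCompact_closedBall (0 : EuclideanSpace ℝ (Fin N)) (|T| + 1))).exists_bound_of_continuousOn
      (f := fun p : ℝ × EuclideanSpace ℝ (Fin N) => fderiv ℝ h (x + p.1 • p.2) p.2)
      (by fun_prop)
    rw [← integral_radial_mul_fderiv_eq_zero hreg hharm hk hT x r]
    refine (hasDerivAt_integral_of_dominated_loc_of_deriv_le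
      (bound := fun z => |k (‖z‖ ^ 2) * C|) (s := Metric.closedBall r 1)
      (F' := fun r z => k (‖z‖ ^ 2) * fderiv ℝ h (x + r • z) z)
      (Metric.closedBall_mem_nhds r one_pos)
      (Eventually.of_forall fun u => (int_k (by fun_prop)).aestronglyMeasurable)
      (int_k (by fun_prop)) (int_k (by fun_prop)).aestronglyMeasurable
      (ae_of_all _ fun z u hu => ?_) (int_k continuous_const).abs
      (ae_of_all _ fun z u _ => ?_)).2
    · by_cases hz : T ≤ ‖z‖ ^ 2
      · simp [hT _ hz]
      · have hz' : z ∈ Metric.closedBall (0 : EuclideanSpace ℝ (Fin N)) (|T| + 1) := by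
          rw [mem_closedBall_zero_iff]
          by_contra! hcon
          nlinarith [abs_nonneg T, le_abs_self T]
        rw [Real.norm_eq_abs, abs_mul, abs_mul]
        exact mul_le_mul_of_nonneg_left ((hC (u, z) ⟨hu, hz'⟩).trans (le_abs_self C))
          (abs_nonneg _)
    · have h1 : HasDerivAt (fun u : ℝ => x + u • z) z u := by
        simpa using ((hasDerivAt_id u).smul_const z).const_add x
      exact ((hreg.differentiable (by norm_num) (x + u • z)).hasFDerivAt.comp_hasDerivAt u
        h1).const_mul _
  have hconst := is_const_of_deriv_eq_zero (fun r => (hd r).differentiableAt)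
    (fun r => (hd r).deriv) 0 1
  simp only [zero_smul, add_zero, one_smul] at hconst
  simp only [mul_sub]
  rw [integral_sub (int_k continuous_const) (int_k (by fun_prop)), hconst, sub_self]

/-- Continuous cut-offs increasing to the indicator function of the interval `(a, b)`. -/
def intervalCutoff (a b : ℝ) (n : ℕ) (r : ℝ) : ℝ :=
  min 1 (n * max 0 (min (r - a) (b - r)))

theorem continuous_intervalCutoff (a b : ℝ) (n : ℕ) : Continuous (intervalCutoff a b n) := by
  unfold intervalCutoff
  fun_prop

theorem intervalCutoff_nonneg (a b : ℝ) (n : ℕ) (r : ℝ) : 0 ≤ intervalCutoff a b n r :=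
  le_min zero_le_one (by positivity)

theorem intervalCutoff_of_notMem {a b r : ℝ} (hr : r ∉ Ioo a b) (n : ℕ) :
    intervalCutoff a b n r = 0 := by
  have : min (r - a) (b - r) ≤ 0 := by
    by_contra! hcon
    obtain ⟨h1, h2⟩ := lt_min_iff.1 hcon
    exact hr ⟨by linarith, by linarith⟩
  simp [intervalCutoff, max_eq_left this]

theorem tendsto_intervalCutoff (a b r : ℝ) :
    Tendsto (fun n => intervalCutoff a b n r) atTop (𝓝 ((Ioo a b).indicator 1 r)) := by
  by_cases hr : r ∈ Ioo a b
  · rw [indicator_of_mem hr]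
    have hpos : 0 < max 0 (min (r - a) (b - r)) :=
      lt_max_of_lt_right (lt_min (by linarith [hr.1]) (by linarith [hr.2]))
    refine tendsto_const_nhds.congr' ?_
    filter_upwards [(tendsto_natCast_atTop_atTop.atTop_mul_const hpos).eventually_ge_atTop
      (1 : ℝ)] with n hn
    exact (min_eq_left hn).symm
  · simp [indicator_of_notMem hr, intervalCutoff_of_notMem hr]

theorem integral_annulus_sub_div_eq_zero {N : ℕ} {h : EuclideanSpace ℝ (Fin N) → ℝ}
    (hreg : ContDiff ℝ 2 h) (hharm : ∀ x, lap N h x = 0) (p : ℝ)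
    (x : EuclideanSpace ℝ (Fin N)) {ε : ℝ} (hε : 0 < ε) :
    ∫ z in annulus N ε, (h x - h (x + z)) / ‖z‖ ^ p = 0 := by
  have hc : Continuous h := hreg.continuous
  set w : ℝ → ℝ := fun r => (max ε r) ^ (-p) with hw
  have hwc : Continuous w :=
    (continuous_const.max continuous_id).rpow_const fun r => Or.inl (lt_max_of_lt_left hε).ne'
  have hann : annulus N ε = {z | ‖z‖ ∈ Ioo ε (1 / ε)} := rfl
  have hmeas : MeasurableSet (annulus N ε) := by
    rw [hann]
    exact measurableSet_Ioo.preimage measurable_norm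
  have hzero : ∀ n, ∫ z, intervalCutoff ε (1 / ε) n ‖z‖ * w ‖z‖ * (h x - h (x + z)) = 0 := by
    intro n
    have key := integral_radial_mul_sub_eq_zero hreg hharm
      (k := fun t => intervalCutoff ε (1 / ε) n (√t) * w (√t)) (T := (1 / ε) ^ 2)
      (((continuous_intervalCutoff _ _ n).comp Real.continuous_sqrt).mul
        (hwc.comp Real.continuous_sqrt))
      (fun t ht => by
        rw [intervalCutoff_of_notMem (fun hm => ?_), zero_mul]
        exact absurd hm.2 (not_lt.2 (Real.le_sqrt_of_sq_le ht))) x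
    simpa using key
  have hbound : Integrable
      ((annulus N ε).indicator fun z => w ‖z‖ * (h x - h (x + z))) := by
    rw [integrable_indicator_iff hmeas]
    refine IntegrableOn.mono_set (t := Metric.closedBall 0 (1 / ε)) ?_ fun z hz => ?_
    · exact ContinuousOn.integrableOn_compact (isCompact_closedBall _ _) (by fun_prop)
    · exact mem_closedBall_zero_iff.2 hz.2.le
  have hlim := tendsto_integral_of_dominated_convergence
    (μ := (volume : Measure (EuclideanSpace ℝ (Fin N))))
    (F := fun n z => intervalCutoff ε (1 / ε) n ‖z‖ * w ‖z‖ * (h x - h (x + z)))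
    (f := fun z => (Ioo ε (1 / ε)).indicator 1 ‖z‖ * w ‖z‖ * (h x - h (x + z)))
    (fun z => ‖(annulus N ε).indicator (fun z => w ‖z‖ * (h x - h (x + z))) z‖)
    (fun n => by
      have := continuous_intervalCutoff ε (1 / ε) n
      exact Continuous.aestronglyMeasurable (by fun_prop))
    hbound.norm
    (fun n => ae_of_all _ fun z => by
      by_cases hz : z ∈ annulus N ε
      · rw [indicator_of_mem hz, mul_assoc, norm_mul]
        refine mul_le_of_le_one_left (norm_nonneg _) ?_
        rw [Real.norm_of_nonneg (intervalCutoff_nonneg _ _ _ _)]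
        exact min_le_left _ _
      · rw [indicator_of_notMem hz, intervalCutoff_of_notMem hz]
        simp)
    (ae_of_all _ fun z =>
      ((tendsto_intervalCutoff ε (1 / ε) ‖z‖).mul_const _).mul_const _)
  simp only [hzero] at hlim
  rw [← integral_indicator hmeas]
  refine Eq.trans (integral_congr_ae (ae_of_all _ fun z => ?_))
    (tendsto_nhds_unique tendsto_const_nhds hlim).symm
  by_cases hz : z ∈ annulus N ε
  · have hz' : ‖z‖ ∈ Ioo ε (1 / ε) := hz
    simp only [indicator_of_mem hz, indicator_of_mem hz', hw, max_eq_right hz.1.le,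
      Real.rpow_neg (norm_nonneg z), Pi.one_apply, one_mul]
    rw [div_eq_inv_mul]
  · have hz' : ‖z‖ ∉ Ioo ε (1 / ε) := hz
    simp only [indicator_of_notMem hz, indicator_of_notMem hz', zero_mul]

/-- Every function harmonic on all of `ℝ^N` is `s`-harmonic in the principal value sense:
each truncated integral vanishes, and consequently the principal value limit is `0`. -/
theorem harmonic_is_sHarmonic
    (N : ℕ) (hN : 2 ≤ N) (s : ℝ) (hs : s ∈ Ioo (0 : ℝ) 1)
    (h : EuclideanSpace ℝ (Fin N) → ℝ) (hreg : ContDiff ℝ 2 h)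
    (hharm : ∀ x, lap N h x = 0) :
    ∀ x : EuclideanSpace ℝ (Fin N),
      (∀ ε ∈ Ioo (0 : ℝ) 1,
        (∫ z in annulus N ε, (h x - h (x + z)) / ‖z‖ ^ ((N : ℝ) + 2 * s)) = 0) ∧
      SHarmonicAt N s h x := by
  intro x
  refine ⟨fun ε hε => integral_annulus_sub_div_eq_zero hreg hharm _ x hε.1, ?_⟩
  refine tendsto_const_nhds.congr' ?_
  filter_upwards [self_mem_nhdsWithin] with ε hε
  rw [pvInt, integral_annulus_sub_div_eq_zero hreg hharm _ x hε, mul_zero]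
end
end

section
/- Let N ≥ 2, m ∈ ℕ with m ≥ 2, and K : (0,∞) → [0,∞) be continuous with ∫_0^{+∞} K(t) t^{N−1+i} dt ∈ (0,+∞] for every i ∈ {2,…,m}. Suppose that lim_{ε→0^+} κ_{i,j}(ε) = 0 for all i, j ∈ {2,…,m} with i < j, where κ_{i,j}(ε) = (∫_ε^{1/ε} K(t) t^{N−1+j} dt)/(∫_ε^{1/ε} K(t) t^{N−1+i} dt). Then ℋ_m^K(ℝ^N) = ℋ_m^1(ℝ^N). -/
open MeasureTheory Real Filter Set Topology

noncomputable section

/-- The truncated integral `∫_{ε<|z|<1/ε} (u(x) - u(x+z)) K(|z|) dz` for a general kernel. -/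
def pvIntK (N : ℕ) (K : ℝ → ℝ) (u : EuclideanSpace ℝ (Fin N) → ℝ)
    (x : EuclideanSpace ℝ (Fin N)) (ε : ℝ) : ℝ :=
  ∫ z in annulus N ε, (u x - u (x + z)) * K ‖z‖

/-- `ℋ_m^K(ℝ^N)`: homogeneous polynomials of degree `m` with `ℒ_K u(x) = 0` for all `x`. -/
def HK (N : ℕ) (K : ℝ → ℝ) (m : ℕ) : Set (EuclideanSpace ℝ (Fin N) → ℝ) :=
  {u | IsHomPoly N m u ∧
    ∀ x, Tendsto (fun ε : ℝ => pvIntK N K u x ε) (𝓝[>] (0 : ℝ)) (𝓝 0)}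

/-- `ℋ_m^1(ℝ^N)`: harmonic homogeneous polynomials of degree `m`. -/
def H1 (N m : ℕ) : Set (EuclideanSpace ℝ (Fin N) → ℝ) :=
  {u | IsHomPoly N m u ∧ ∀ x, lap N u x = 0}

/-- `𝒫_m(ℝ^N)`: homogeneous polynomials of degree `m`. -/
def Pm (N m : ℕ) : Set (EuclideanSpace ℝ (Fin N) → ℝ) :=
  {u | IsHomPoly N m u}


/-- The formal Laplacian of a polynomial. -/
def mvLap {N : ℕ} (p : MvPolynomial (Fin N) ℝ) : MvPolynomial (Fin N) ℝ :=
  ∑ i, MvPolynomial.pderiv i (MvPolynomial.pderiv i p)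

/-- The polynomial function on Euclidean space attached to a polynomial. -/
def evalE {N : ℕ} (p : MvPolynomial (Fin N) ℝ) (x : EuclideanSpace ℝ (Fin N)) : ℝ :=
  MvPolynomial.eval (fun i => x i) p

/-- The polynomial `z ↦ p (x + z)`. -/
def mvTranslate {N : ℕ} (x : EuclideanSpace ℝ (Fin N)) (p : MvPolynomial (Fin N) ℝ) :
    MvPolynomial (Fin N) ℝ :=
  MvPolynomial.bind₁ (fun i => MvPolynomial.X i + MvPolynomial.C (x i)) p

theorem continuous_evalE {N : ℕ} (p : MvPolynomial (Fin N) ℝ) : Continuous (evalE p) := by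
  unfold evalE
  exact (MvPolynomial.continuous_eval p).comp (by fun_prop)

theorem evalE_zero {N : ℕ} (p : MvPolynomial (Fin N) ℝ) :
    evalE p 0 = MvPolynomial.coeff 0 p := by
  rw [← MvPolynomial.constantCoeff_eq, ← MvPolynomial.eval_zero]
  rfl

theorem evalE_mvTranslate {N : ℕ} (x z : EuclideanSpace ℝ (Fin N))
    (p : MvPolynomial (Fin N) ℝ) : evalE (mvTranslate x p) z = evalE p (x + z) := by
  unfold evalE mvTranslate
  induction p using MvPolynomial.induction_on with
  | C a => simp
  | add p q hp hq => simp [hp, hq]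
  | mul_X p i hp => simp [hp, add_comm]

theorem pderiv_mvTranslate {N : ℕ} (x : EuclideanSpace ℝ (Fin N)) (i : Fin N)
    (p : MvPolynomial (Fin N) ℝ) :
    MvPolynomial.pderiv i (mvTranslate x p) = mvTranslate x (MvPolynomial.pderiv i p) := by
  unfold mvTranslate
  induction p using MvPolynomial.induction_on with
  | C a => simp [MvPolynomial.algebraMap_eq]
  | add p q hp hq => simp [hp, hq]
  | mul_X p j hp =>
    rw [map_mul, MvPolynomial.pderiv_mul, MvPolynomial.pderiv_mul, hp]
    by_cases hij : j = i
    · subst hij; simp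
    · simp [MvPolynomial.pderiv_X_of_ne hij]

theorem mvLap_mvTranslate {N : ℕ} (x : EuclideanSpace ℝ (Fin N))
    (p : MvPolynomial (Fin N) ℝ) : mvLap (mvTranslate x p) = mvTranslate x (mvLap p) := by
  unfold mvLap
  simp only [pderiv_mvTranslate]
  simp [mvTranslate]

theorem totalDegree_mvTranslate_le {N : ℕ} (x : EuclideanSpace ℝ (Fin N))
    (p : MvPolynomial (Fin N) ℝ) : (mvTranslate x p).totalDegree ≤ p.totalDegree := by
  unfold mvTranslate
  rw [MvPolynomial.bind₁, MvPolynomial.aeval_def, MvPolynomial.eval₂_eq']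
  refine MvPolynomial.totalDegree_finsetSum_le fun d hd => ?_
  refine (MvPolynomial.totalDegree_mul _ _).trans ?_
  rw [MvPolynomial.algebraMap_eq, MvPolynomial.totalDegree_C, zero_add]
  refine (MvPolynomial.totalDegree_finsetProd _ _).trans ?_
  refine le_trans ?_ (MvPolynomial.le_totalDegree hd)
  rw [Finsupp.sum_fintype _ _ (fun _ => rfl)]
  refine Finset.sum_le_sum fun i _ => (MvPolynomial.totalDegree_pow _ _).trans ?_
  have h : (MvPolynomial.X i + MvPolynomial.C (x i) : MvPolynomial (Fin N) ℝ).totalDegree ≤ 1 := by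
    refine (MvPolynomial.totalDegree_add _ _).trans ?_
    simp
  calc d i * _ ≤ d i * 1 := Nat.mul_le_mul_left _ h
    _ = d i := mul_one _

theorem mvLap_homogeneousComponent_add_two {N : ℕ} (k : ℕ) (p : MvPolynomial (Fin N) ℝ) :
    mvLap (MvPolynomial.homogeneousComponent (k + 2) p) =
      MvPolynomial.homogeneousComponent k (mvLap p) := by
  unfold mvLap
  rw [map_sum]
  refine Finset.sum_congr rfl fun i _ => ?_
  ext d
  simp only [MvPolynomial.coeff_pderiv, MvPolynomial.coeff_homogeneousComponent, map_add,
    Finsupp.degree_single]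
  by_cases h : d.degree = k
  · simp [h]
  · rw [if_neg (by omega), if_neg h]; simp

theorem mvLap_of_isHomogeneous_one {N : ℕ} {p : MvPolynomial (Fin N) ℝ}
    (hp : p.IsHomogeneous 1) : mvLap p = 0 := by
  unfold mvLap
  refine Finset.sum_eq_zero fun i _ => ?_
  have h : (MvPolynomial.pderiv i p).IsHomogeneous 0 := hp.pderiv
  rw [← MvPolynomial.totalDegree_zero_iff_isHomogeneous,
    MvPolynomial.totalDegree_eq_zero_iff_eq_C] at h
  rw [h, MvPolynomial.pderiv_C]

theorem mvLap_homogeneousComponent_eq_zero {N : ℕ} {p : MvPolynomial (Fin N) ℝ}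
    (hp : mvLap p = 0) {k : ℕ} (hk : 1 ≤ k) :
    mvLap (MvPolynomial.homogeneousComponent k p) = 0 := by
  obtain _ | _ | k := k
  · omega
  · exact mvLap_of_isHomogeneous_one (MvPolynomial.homogeneousComponent_isHomogeneous 1 p)
  · rw [mvLap_homogeneousComponent_add_two, hp, map_zero]

theorem hasFDerivAt_evalE {N : ℕ} (p : MvPolynomial (Fin N) ℝ)
    (x : EuclideanSpace ℝ (Fin N)) :
    HasFDerivAt (evalE p) (∑ i, evalE (MvPolynomial.pderiv i p) x •
      (EuclideanSpace.proj i : EuclideanSpace ℝ (Fin N) →L[ℝ] ℝ)) x := by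
  induction p using MvPolynomial.induction_on with
  | C a =>
    have h : evalE (MvPolynomial.C a : MvPolynomial (Fin N) ℝ) = fun _ => a := by
      ext; simp [evalE]
    rw [h]
    exact (hasFDerivAt_const a x).congr_fderiv (by simp [evalE])
  | add p q hp hq =>
    have h : evalE (p + q) = evalE p + evalE q := by ext; simp [evalE]
    rw [h]
    exact (hp.add hq).congr_fderiv (by simp [evalE, add_smul, Finset.sum_add_distrib])
  | mul_X p j hp =>
    have h : evalE (p * MvPolynomial.X j) =
        evalE p * ⇑(EuclideanSpace.proj j : EuclideanSpace ℝ (Fin N) →L[ℝ] ℝ) := by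
      ext; simp [evalE]
    rw [h]
    refine (hp.mul
      (EuclideanSpace.proj j : EuclideanSpace ℝ (Fin N) →L[ℝ] ℝ).hasFDerivAt).congr_fderiv ?_
    have h : ∀ i, evalE (MvPolynomial.pderiv i (p * MvPolynomial.X j)) x
        = evalE p x * (if i = j then 1 else 0) + x j * evalE (MvPolynomial.pderiv i p) x := by
      intro i
      by_cases hij : j = i
      · subst hij; simp [evalE, mul_comm]
      · simp [MvPolynomial.pderiv_X_of_ne hij, evalE, Ne.symm hij, mul_comm]
    simp only [h, add_smul, Finset.sum_add_distrib, mul_smul, ← Finset.smul_sum]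
    simp

theorem fderiv_evalE_single {N : ℕ} (p : MvPolynomial (Fin N) ℝ)
    (x : EuclideanSpace ℝ (Fin N)) (i : Fin N) :
    fderiv ℝ (evalE p) x (EuclideanSpace.single i 1) = evalE (MvPolynomial.pderiv i p) x := by
  rw [(hasFDerivAt_evalE p x).fderiv]
  simp

theorem lap_evalE {N : ℕ} (p : MvPolynomial (Fin N) ℝ) (x : EuclideanSpace ℝ (Fin N)) :
    lap N (evalE p) x = evalE (mvLap p) x := by
  have hsum : evalE (mvLap p) x =
      ∑ i, evalE (MvPolynomial.pderiv i (MvPolynomial.pderiv i p)) x := by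
    simp [evalE, mvLap]
  rw [hsum, lap]
  refine Finset.sum_congr rfl fun i _ => ?_
  rw [iteratedFDeriv_two_apply]
  have hd : DifferentiableAt ℝ (fderiv ℝ (evalE p)) x := by
    have : fderiv ℝ (evalE p) = fun y => ∑ i, evalE (MvPolynomial.pderiv i p) y •
      (EuclideanSpace.proj i : EuclideanSpace ℝ (Fin N) →L[ℝ] ℝ) :=
      funext fun y => (hasFDerivAt_evalE p y).fderiv
    rw [this]
    refine DifferentiableAt.fun_sum fun j _ => ?_
    exact ((hasFDerivAt_evalE _ x).differentiableAt).smul_const _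
  rw [← fderiv_evalE_single]
  have h2 : evalE (MvPolynomial.pderiv i p) =
      fun y => fderiv ℝ (evalE p) y (EuclideanSpace.single i 1) :=
    funext fun y => (fderiv_evalE_single p y i).symm
  rw [h2, fderiv_clm_apply hd (differentiableAt_const _)]
  simp

theorem evalE_smul {N : ℕ} {k : ℕ} {p : MvPolynomial (Fin N) ℝ} (hp : p.IsHomogeneous k)
    (t : ℝ) (x : EuclideanSpace ℝ (Fin N)) : evalE p (t • x) = t ^ k * evalE p x := by
  unfold evalE
  rw [MvPolynomial.eval_eq', MvPolynomial.eval_eq', Finset.mul_sum]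
  refine Finset.sum_congr rfl fun d hd => ?_
  have hdeg : ∑ i, d i = k := by
    have := hp (MvPolynomial.mem_support_iff.mp hd)
    rw [Finsupp.weight_apply, Finsupp.sum_fintype _ _ (by simp)] at this
    simpa using this
  simp only [PiLp.smul_apply, smul_eq_mul, mul_pow, Finset.prod_mul_distrib,
    Finset.prod_pow_eq_pow_sum, hdeg]
  ring

theorem sum_evalE_homogeneousComponent {N m : ℕ} {q : MvPolynomial (Fin N) ℝ}
    (hq : q.totalDegree ≤ m) (z : EuclideanSpace ℝ (Fin N)) :
    evalE q z = evalE q 0 +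
      ∑ k ∈ Finset.Icc 1 m, evalE (MvPolynomial.homogeneousComponent k q) z := by
  have h : ∑ k ∈ Finset.range (m + 1), MvPolynomial.homogeneousComponent k q = q := by
    conv_rhs => rw [← MvPolynomial.sum_homogeneousComponent q]
    symm
    refine Finset.sum_subset (Finset.range_mono (by omega)) fun k _ hk => ?_
    exact MvPolynomial.homogeneousComponent_eq_zero _ _ (by simpa using hk)
  have h0 : evalE (MvPolynomial.homogeneousComponent 0 q) z = evalE q 0 := by
    rw [MvPolynomial.homogeneousComponent_zero, evalE_zero, evalE, MvPolynomial.eval_C]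
  conv_lhs => rw [← h]
  rw [Finset.sum_range_succ', add_comm, ← h0]
  have : Finset.Icc 1 m = (Finset.range m).map ⟨(· + 1), add_left_injective 1⟩ := by
    ext a; simp only [Finset.mem_Icc, Finset.mem_map, Finset.mem_range, Function.Embedding.coeFn_mk]
    constructor
    · rintro ⟨h1, h2⟩; exact ⟨a - 1, by omega, by omega⟩
    · rintro ⟨b, hb, rfl⟩; omega
  rw [this, Finset.sum_map]
  simp [evalE]

theorem integral_mul_radial {N : ℕ} (hN : 2 ≤ N) {k : ℕ}
    {f : EuclideanSpace ℝ (Fin N) → ℝ}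
    (hf : ∀ t : ℝ, 0 < t → ∀ z, f (t • z) = t ^ k * f z) (φ : ℝ → ℝ) :
    ∫ z, f z * φ ‖z‖ =
      (∫ w, f w.1 ∂(volume : Measure (EuclideanSpace ℝ (Fin N))).toSphere) *
        ∫ t in Ioi (0 : ℝ), t ^ (N - 1) * (t ^ k * φ t) := by
  have : NeZero N := ⟨by omega⟩
  have hdim : Module.finrank ℝ (EuclideanSpace ℝ (Fin N)) = N := by simp
  set μ := (volume : Measure (EuclideanSpace ℝ (Fin N)))
  calc
    ∫ z, f z * φ ‖z‖ ∂μ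
      = ∫ z : ({(0)}ᶜ : Set (EuclideanSpace ℝ (Fin N))), f z * φ ‖z.1‖ ∂(μ.comap (↑)) := by
        rw [integral_subtype_comap (measurableSet_singleton _).compl fun z => f z * φ ‖z‖,
          restrict_compl_singleton]
    _ = ∫ y, f y.1.1 * (y.2.1 ^ k * φ y.2.1)
          ∂μ.toSphere.prod (.volumeIoiPow (Module.finrank ℝ (EuclideanSpace ℝ (Fin N)) - 1)) := by
        rw [← μ.measurePreserving_homeomorphUnitSphereProd.integral_comp
          (Homeomorph.measurableEmbedding _)]
        refine integral_congr_ae (Eventually.of_forall fun z => ?_)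
        have hz : 0 < ‖z.1‖ := norm_pos_iff.mpr z.2
        have h2 : z.1 = ‖z.1‖ • (‖z.1‖⁻¹ • z.1) := by
          rw [smul_smul, mul_inv_cancel₀ hz.ne', one_smul]
        have h3 : f z.1 = ‖z.1‖ ^ k * f (‖z.1‖⁻¹ • z.1) := by
          conv_lhs => rw [h2]
          exact hf _ hz _
        simp [h3]
        ring
    _ = (∫ w, f w.1 ∂μ.toSphere) * ∫ t : Ioi (0 : ℝ), t.1 ^ k * φ t.1
          ∂.volumeIoiPow (Module.finrank ℝ (EuclideanSpace ℝ (Fin N)) - 1) :=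
        integral_prod_mul (fun w : Metric.sphere (0 : EuclideanSpace ℝ (Fin N)) 1 => f w.1)
          (fun t : Ioi (0 : ℝ) => t.1 ^ k * φ t.1)
    _ = _ := by
      rw [hdim]
      simp only [Measure.volumeIoiPow, ENNReal.ofReal]
      rw [integral_withDensity_eq_integral_smul,
        integral_subtype_comap measurableSet_Ioi
          fun a => Real.toNNReal (a ^ (N - 1)) • (a ^ k * φ a),
        setIntegral_congr_fun measurableSet_Ioi fun x hx => ?_]
      · rw [NNReal.smul_def, Real.coe_toNNReal _ (pow_nonneg hx.out.le _), smul_eq_mul]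
      · exact (measurable_subtype_coe.pow_const _).real_toNNReal

theorem hasDerivAt_sq_max_zero (s : ℝ) :
    HasDerivAt (fun s : ℝ => max 0 s ^ 2) (2 * max 0 s) s := by
  rcases lt_trichotomy s 0 with hs | rfl | hs
  · rw [max_eq_left hs.le, mul_zero]
    refine (hasDerivAt_const s (0 : ℝ)).congr_of_eventuallyEq ?_
    filter_upwards [Iio_mem_nhds hs] with t ht
    simp [max_eq_left (le_of_lt (mem_Iio.mp ht))]
  · rw [max_self, mul_zero, hasDerivAt_iff_isLittleO_nhds_zero]
    simp only [zero_add, max_self, smul_zero, sub_zero, ne_eq, OfNat.ofNat_ne_zero,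
      not_false_eq_true, zero_pow]
    refine Asymptotics.IsBigO.trans_isLittleO (g := fun h : ℝ => h ^ 2) ?_ ?_
    · refine Asymptotics.IsBigO.of_bound 1 (Eventually.of_forall fun h => ?_)
      rw [one_mul, norm_pow, norm_pow]
      refine pow_le_pow_left₀ (norm_nonneg _) ?_ 2
      rw [Real.norm_eq_abs, Real.norm_eq_abs, abs_of_nonneg (le_max_left _ _)]
      exact max_le (abs_nonneg h) (le_abs_self h)
    · simpa using Asymptotics.isLittleO_pow_pow (𝕜 := ℝ) (m := 1) (n := 2) (by norm_num)
  · rw [max_eq_right hs.le]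
    refine HasDerivAt.congr_of_eventuallyEq (f := fun s : ℝ => s ^ 2) ?_ ?_
    · simpa using hasDerivAt_pow 2 s
    · filter_upwards [Ioi_mem_nhds hs] with t ht
      simp [max_eq_right (le_of_lt (mem_Ioi.mp ht))]

/-- The compactly supported radial profile `max(0, 1 - t²)`. -/
def capProfile (t : ℝ) : ℝ := max 0 (1 - t ^ 2)

theorem continuous_capProfile : Continuous capProfile := by
  unfold capProfile; fun_prop

theorem capProfile_nonneg (t : ℝ) : 0 ≤ capProfile t := le_max_left _ _

theorem hasFDerivAt_sq_capProfile_norm {N : ℕ} (z : EuclideanSpace ℝ (Fin N)) :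
    HasFDerivAt (fun z : EuclideanSpace ℝ (Fin N) => capProfile ‖z‖ ^ 2)
      ((2 * capProfile ‖z‖) • -((2 : ℕ) • (innerSL ℝ z : EuclideanSpace ℝ (Fin N) →L[ℝ] ℝ))) z := by
  have h1 : HasFDerivAt (fun z : EuclideanSpace ℝ (Fin N) => 1 - ‖z‖ ^ 2)
      (-((2 : ℕ) • (innerSL ℝ z : EuclideanSpace ℝ (Fin N) →L[ℝ] ℝ))) z :=
    (hasStrictFDerivAt_norm_sq z).hasFDerivAt.const_sub 1
  exact (hasDerivAt_sq_max_zero (1 - ‖z‖ ^ 2)).comp_hasFDerivAt z h1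

theorem hasCompactSupport_mul_capProfile_pow {N : ℕ} (f : EuclideanSpace ℝ (Fin N) → ℝ)
    {n : ℕ} (hn : n ≠ 0) : HasCompactSupport (fun z => f z * capProfile ‖z‖ ^ n) := by
  refine HasCompactSupport.intro (isCompact_closedBall (0 : EuclideanSpace ℝ (Fin N)) 1)
    fun z hz => ?_
  have h : 1 < ‖z‖ := by simpa using hz
  have h2 : capProfile ‖z‖ = 0 := max_eq_left (by nlinarith)
  simp [h2, hn]

theorem integrable_mul_capProfile_pow {N : ℕ} {f : EuclideanSpace ℝ (Fin N) → ℝ}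
    (hf : Continuous f) {n : ℕ} (hn : n ≠ 0) :
    Integrable (fun z => f z * capProfile ‖z‖ ^ n) := by
  refine Continuous.integrable_of_hasCompactSupport ?_ (hasCompactSupport_mul_capProfile_pow f hn)
  exact hf.mul ((continuous_capProfile.comp continuous_norm).pow n)

theorem integral_mul_capProfile_of_isHomogeneous {N k : ℕ} {p : MvPolynomial (Fin N) ℝ}
    (hp : p.IsHomogeneous k) :
    4 * k * ∫ z, evalE p z * capProfile ‖z‖ = ∫ z, evalE (mvLap p) z * capProfile ‖z‖ ^ 2 := by
  have hint : ∀ i : Fin N, Integrable fun z : EuclideanSpace ℝ (Fin N) =>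
      (z i * evalE (MvPolynomial.pderiv i p) z) * capProfile ‖z‖ := by
    intro i
    have hc : Continuous fun z : EuclideanSpace ℝ (Fin N) =>
        z i * evalE (MvPolynomial.pderiv i p) z :=
      Continuous.mul (by fun_prop) (continuous_evalE _)
    simpa using integrable_mul_capProfile_pow hc one_ne_zero
  have hparts : ∀ i : Fin N,
      4 * ∫ z, (z i * evalE (MvPolynomial.pderiv i p) z) * capProfile ‖z‖ =
        ∫ z, evalE (MvPolynomial.pderiv i (MvPolynomial.pderiv i p)) z * capProfile ‖z‖ ^ 2 := by
    intro i
    have hder : ∀ z : EuclideanSpace ℝ (Fin N),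
        fderiv ℝ (fun z : EuclideanSpace ℝ (Fin N) => capProfile ‖z‖ ^ 2) z
          (EuclideanSpace.single i 1) = -4 * (z i * capProfile ‖z‖) := by
      intro z
      rw [(hasFDerivAt_sq_capProfile_norm z).fderiv]
      simp [EuclideanSpace.inner_single_right]
      ring
    have hmain := integral_mul_fderiv_eq_neg_fderiv_mul_of_integrable
      (μ := (volume : Measure (EuclideanSpace ℝ (Fin N)))) (𝕜 := ℝ)
      (f := evalE (MvPolynomial.pderiv i p))
      (g := fun z : EuclideanSpace ℝ (Fin N) => capProfile ‖z‖ ^ 2)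
      (v := EuclideanSpace.single i 1) ?_ ?_ ?_
      (fun x _ => (hasFDerivAt_evalE _ x).differentiableAt)
      (fun x _ => (hasFDerivAt_sq_capProfile_norm x).differentiableAt)
    · simp only [hder, fderiv_evalE_single] at hmain
      have h2 : ∀ z : EuclideanSpace ℝ (Fin N),
          evalE (MvPolynomial.pderiv i p) z * (-4 * (z i * capProfile ‖z‖)) =
            -4 * ((z i * evalE (MvPolynomial.pderiv i p) z) * capProfile ‖z‖) := by
        intro z; ring
      simp only [h2, integral_const_mul] at hmain
      linarith
    · simp only [fderiv_evalE_single]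
      exact integrable_mul_capProfile_pow (continuous_evalE _) two_ne_zero
    · simp only [hder]
      refine ((hint i).const_mul (-4)).congr (Eventually.of_forall fun z => ?_)
      ring
    · exact integrable_mul_capProfile_pow (continuous_evalE _) two_ne_zero
  have heuler : ∀ z : EuclideanSpace ℝ (Fin N),
      (k : ℝ) * (evalE p z * capProfile ‖z‖) =
        ∑ i, (z i * evalE (MvPolynomial.pderiv i p) z) * capProfile ‖z‖ := by
    intro z
    have h := congrArg (fun q => evalE q z) hp.sum_X_mul_pderiv
    simp only [evalE, map_sum, map_mul, MvPolynomial.eval_X, nsmul_eq_mul, map_natCast] at h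
    rw [← Finset.sum_mul, ← mul_assoc]
    simp only [evalE, h]
  have hlap : ∀ z : EuclideanSpace ℝ (Fin N),
      evalE (mvLap p) z * capProfile ‖z‖ ^ 2 =
        ∑ i, evalE (MvPolynomial.pderiv i (MvPolynomial.pderiv i p)) z * capProfile ‖z‖ ^ 2 := by
    intro z
    rw [← Finset.sum_mul]
    simp [evalE, mvLap]
  simp only [hlap]
  rw [mul_assoc, ← integral_const_mul]
  simp only [heuler]
  rw [integral_finsetSum _ fun i _ => hint i, Finset.mul_sum, integral_finsetSum _ fun i _ =>
    integrable_mul_capProfile_pow (continuous_evalE _) two_ne_zero]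
  exact Finset.sum_congr rfl fun i _ => hparts i

/-- The integral of a polynomial over the unit sphere. -/
def sphereInt {N : ℕ} (p : MvPolynomial (Fin N) ℝ) : ℝ :=
  ∫ w, evalE p w.1 ∂(volume : Measure (EuclideanSpace ℝ (Fin N))).toSphere

theorem integral_evalE_mul_radial {N : ℕ} (hN : 2 ≤ N) {k : ℕ} {p : MvPolynomial (Fin N) ℝ}
    (hp : p.IsHomogeneous k) (φ : ℝ → ℝ) :
    ∫ z, evalE p z * φ ‖z‖ =
      sphereInt p * ∫ t in Ioi (0 : ℝ), t ^ (N - 1) * (t ^ k * φ t) :=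
  integral_mul_radial hN (fun t _ z => evalE_smul hp t z) φ

theorem integral_mul_capProfile_pow_pos {N : ℕ} (hN : 2 ≤ N)
    {f : EuclideanSpace ℝ (Fin N) → ℝ} (hf : Continuous f) (hf0 : ∀ z, z ≠ 0 → 0 < f z)
    {n : ℕ} (hn : n ≠ 0) : 0 < ∫ z, f z * capProfile ‖z‖ ^ n := by
  set z₀ : EuclideanSpace ℝ (Fin N) := EuclideanSpace.single ⟨0, by omega⟩ (1 / 2)
  have hz₀ : ‖z₀‖ = 1 / 2 := by simp [z₀]
  have hz₀' : z₀ ≠ 0 := by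
    rw [← norm_pos_iff, hz₀]; norm_num
  have hfn : ∀ z, 0 ≤ f z := by
    have : Dense {z : EuclideanSpace ℝ (Fin N) | z ≠ 0} := by
      have : NeZero N := ⟨by omega⟩
      exact dense_compl_singleton 0
    exact fun z => this.induction (P := fun z => 0 ≤ f z) (fun z hz => (hf0 z hz).le)
      (isClosed_le continuous_const hf) z
  refine Continuous.integral_pos_of_hasCompactSupport_nonneg_nonzero (x := z₀)
    (hf.mul ((continuous_capProfile.comp continuous_norm).pow n))
    (hasCompactSupport_mul_capProfile_pow f hn)
    (fun z => mul_nonneg (hfn z) (pow_nonneg (capProfile_nonneg _) _)) ?_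
  rw [hz₀]
  refine mul_ne_zero (hf0 z₀ hz₀').ne' (pow_ne_zero _ ?_)
  norm_num [capProfile]

/-- Mean value property on the unit sphere. -/
theorem sphereInt_eq_zero_of_mvLap_eq_zero {N : ℕ} (hN : 2 ≤ N) {k : ℕ} (hk : 1 ≤ k)
    {p : MvPolynomial (Fin N) ℝ} (hp : p.IsHomogeneous k) (hlap : mvLap p = 0) :
    sphereInt p = 0 := by
  have h1 := integral_mul_capProfile_of_isHomogeneous hp
  rw [hlap, integral_evalE_mul_radial hN hp capProfile] at h1
  have h0 : (∫ z : EuclideanSpace ℝ (Fin N),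
      evalE (0 : MvPolynomial (Fin N) ℝ) z * capProfile ‖z‖ ^ 2) = 0 := by simp [evalE]
  rw [h0] at h1
  have h2 := integral_mul_radial (k := k) hN (f := fun z => ‖z‖ ^ k)
    (fun t ht z => by rw [norm_smul, mul_pow, Real.norm_of_nonneg ht.le]) capProfile
  have h3 : 0 < ∫ z : EuclideanSpace ℝ (Fin N), ‖z‖ ^ k * capProfile ‖z‖ := by
    simpa using integral_mul_capProfile_pow_pos hN (f := fun z => ‖z‖ ^ k) (by fun_prop)
      (fun z hz => pow_pos (norm_pos_iff.mpr hz) k) one_ne_zero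
  rw [h2] at h3
  have h4 := right_ne_zero_of_mul h3.ne'
  have hk' : (4 * k : ℝ) ≠ 0 := by positivity
  simpa [h4, hk', show k ≠ 0 by omega] using h1

theorem evalE_mvLap_eq_zero_of_sphereInt_eq_zero {N : ℕ} (hN : 2 ≤ N)
    {p : MvPolynomial (Fin N) ℝ} (hp : p.IsHomogeneous 2) (hs : sphereInt p = 0)
    (z : EuclideanSpace ℝ (Fin N)) : evalE (mvLap p) z = 0 := by
  have h : (mvLap p).IsHomogeneous 0 :=
    MvPolynomial.IsHomogeneous.sum _ _ _ fun i _ => (hp.pderiv (i := i)).pderiv (i := i)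
  rw [← MvPolynomial.totalDegree_zero_iff_isHomogeneous,
    MvPolynomial.totalDegree_eq_zero_iff_eq_C] at h
  have h1 := integral_mul_capProfile_of_isHomogeneous hp
  rw [integral_evalE_mul_radial hN hp capProfile, hs, zero_mul, mul_zero, h] at h1
  simp only [evalE, MvPolynomial.eval_C, integral_const_mul] at h1
  have h3 := integral_mul_capProfile_pow_pos hN (f := fun _ => (1 : ℝ)) continuous_const
    (fun _ _ => one_pos) two_ne_zero
  simp only [one_mul] at h3
  rw [h, evalE, MvPolynomial.eval_C]
  exact (mul_eq_zero.mp h1.symm).resolve_right h3.ne'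

/-- The truncated moment `∫_ε^{1/ε} K(t) t^{N-1+k} dt`. -/
def moment (N : ℕ) (K : ℝ → ℝ) (k : ℕ) (ε : ℝ) : ℝ :=
  ∫ t in Ioo ε (1 / ε), K t * t ^ ((N : ℝ) - 1 + (k : ℝ))

theorem integrableOn_moment (N : ℕ) {K : ℝ → ℝ} (hK : ContinuousOn K (Ioi 0)) (k : ℕ) {ε : ℝ}
    (hε : 0 < ε) : IntegrableOn (fun t => K t * t ^ ((N : ℝ) - 1 + (k : ℝ))) (Ioo ε (1 / ε)) := by
  have hsub : Icc ε (1 / ε) ⊆ Ioi 0 := fun t ht => hε.trans_le ht.1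
  refine (ContinuousOn.integrableOn_compact isCompact_Icc ?_).mono_set Ioo_subset_Icc_self
  refine (hK.mono hsub).mul fun t ht => ?_
  exact (Real.continuousAt_rpow_const t _ (Or.inl (hsub ht).out.ne')).continuousWithinAt

theorem integral_indicator_eq_moment {N : ℕ} (hN : 2 ≤ N) (K : ℝ → ℝ) (k : ℕ) {ε : ℝ}
    (hε : 0 < ε) :
    ∫ t in Ioi (0 : ℝ), t ^ (N - 1) * (t ^ k * (Ioo ε (1 / ε)).indicator K t) =
      moment N K k ε := by
  have h : ∀ t : ℝ, t ^ (N - 1) * (t ^ k * (Ioo ε (1 / ε)).indicator K t) =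
      (Ioo ε (1 / ε)).indicator (fun t => K t * t ^ ((N : ℝ) - 1 + (k : ℝ))) t := by
    intro t
    by_cases ht : t ∈ Ioo ε (1 / ε)
    · rw [indicator_of_mem ht, indicator_of_mem ht]
      have h1 : (N : ℝ) - 1 + (k : ℝ) = ((N - 1 + k : ℕ) : ℝ) := by
        push_cast [Nat.cast_sub (show 1 ≤ N by omega)]; ring
      rw [h1, Real.rpow_natCast, pow_add]
      ring
    · rw [indicator_of_notMem ht, indicator_of_notMem ht, mul_zero, mul_zero]
  simp only [h]
  rw [setIntegral_indicator measurableSet_Ioo, moment,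
    inter_eq_self_of_subset_right (s := Ioi 0) fun t ht => hε.trans ht.1]

theorem pvIntK_evalE {N : ℕ} (hN : 2 ≤ N) {m : ℕ} {K : ℝ → ℝ} (hK : ContinuousOn K (Ioi 0))
    {p : MvPolynomial (Fin N) ℝ} (hp : p.totalDegree ≤ m) (x : EuclideanSpace ℝ (Fin N))
    {ε : ℝ} (hε : 0 < ε) :
    pvIntK N K (evalE p) x ε =
      -∑ k ∈ Finset.Icc 1 m,
        sphereInt (MvPolynomial.homogeneousComponent k (mvTranslate x p)) * moment N K k ε := by
  set q := mvTranslate x p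
  have hq : q.totalDegree ≤ m := (totalDegree_mvTranslate_le x p).trans hp
  have hmeas : MeasurableSet (annulus N ε) := by
    refine IsOpen.measurableSet ?_
    exact (isOpen_lt continuous_const continuous_norm).inter
      (isOpen_lt continuous_norm continuous_const)
  have hind : ∀ (f : EuclideanSpace ℝ (Fin N) → ℝ) z,
      (annulus N ε).indicator (fun z => f z * K ‖z‖) z =
        f z * (Ioo ε (1 / ε)).indicator K ‖z‖ := by
    intro f z
    by_cases hz : z ∈ annulus N ε
    · rw [indicator_of_mem hz, indicator_of_mem (show ‖z‖ ∈ Ioo ε (1 / ε) from hz)]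
    · rw [indicator_of_notMem hz, indicator_of_notMem (show ‖z‖ ∉ Ioo ε (1 / ε) from hz),
        mul_zero]
  have hint : ∀ k, Integrable fun z => evalE (MvPolynomial.homogeneousComponent k q) z *
      (Ioo ε (1 / ε)).indicator K ‖z‖ := by
    intro k
    simp only [← hind]
    rw [integrable_indicator_iff hmeas]
    have hcomp : IsCompact {z : EuclideanSpace ℝ (Fin N) | ε ≤ ‖z‖ ∧ ‖z‖ ≤ 1 / ε} := by
      refine (isCompact_closedBall (0 : EuclideanSpace ℝ (Fin N)) (1 / ε)).of_isClosed_subset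
        ((isClosed_le continuous_const continuous_norm).inter
          (isClosed_le continuous_norm continuous_const)) fun z hz => ?_
      simpa using hz.2
    refine (ContinuousOn.integrableOn_compact hcomp ?_).mono_set
      fun z hz => ⟨hz.1.le, hz.2.le⟩
    exact (continuous_evalE _).continuousOn.mul
      (hK.comp continuous_norm.continuousOn fun z hz => hε.trans_le hz.1)
  have hdiff : ∀ z, evalE p x - evalE p (x + z) =
      -∑ k ∈ Finset.Icc 1 m, evalE (MvPolynomial.homogeneousComponent k q) z := by
    intro z
    have h0 : evalE q 0 = evalE p x := by rw [evalE_mvTranslate, add_zero]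
    rw [← evalE_mvTranslate, sum_evalE_homogeneousComponent hq z, h0]
    ring
  rw [pvIntK, ← integral_indicator hmeas]
  simp only [hind fun z => evalE p x - evalE p (x + z)]
  simp only [hdiff, neg_mul, Finset.sum_mul]
  rw [integral_neg, integral_finsetSum _ fun k _ => hint k]
  refine congrArg _ (Finset.sum_congr rfl fun k _ => ?_)
  rw [integral_evalE_mul_radial hN (MvPolynomial.homogeneousComponent_isHomogeneous k q),
    integral_indicator_eq_moment hN K k hε]

theorem moment_nonneg (N : ℕ) {K : ℝ → ℝ} (hKpos : ∀ t ∈ Ioi (0 : ℝ), 0 ≤ K t) (k : ℕ) {ε : ℝ}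
    (hε : 0 < ε) : 0 ≤ moment N K k ε :=
  setIntegral_nonneg measurableSet_Ioo fun t ht =>
    mul_nonneg (hKpos t (hε.trans ht.1)) (Real.rpow_nonneg (hε.trans ht.1).le _)

theorem moment_anti (N : ℕ) {K : ℝ → ℝ} (hK : ContinuousOn K (Ioi 0))
    (hKpos : ∀ t ∈ Ioi (0 : ℝ), 0 ≤ K t) (k : ℕ) {ε δ : ℝ} (hε : 0 < ε) (hεδ : ε ≤ δ) :
    moment N K k δ ≤ moment N K k ε := by
  refine setIntegral_mono_set (integrableOn_moment N hK k hε) ?_ ?_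
  · refine (ae_restrict_iff' measurableSet_Ioo).mpr (Eventually.of_forall fun t ht => ?_)
    exact mul_nonneg (hKpos t (hε.trans ht.1)) (Real.rpow_nonneg (hε.trans ht.1).le _)
  · exact (Ioo_subset_Ioo hεδ (one_div_le_one_div_of_le hε hεδ)).eventuallyLE

theorem exists_moment_pos (N : ℕ) {K : ℝ → ℝ} (hK : ContinuousOn K (Ioi 0))
    (hKpos : ∀ t ∈ Ioi (0 : ℝ), 0 ≤ K t) (k : ℕ)
    (hKint : 0 < ∫⁻ t in Ioi (0 : ℝ), ENNReal.ofReal (K t * t ^ ((N : ℝ) - 1 + (k : ℝ)))) :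
    ∃ δ, 0 < δ ∧ 0 < moment N K k δ := by
  by_contra! hcon
  refine hKint.ne' (le_antisymm ?_ zero_le)
  have hsub : Ioi (0 : ℝ) ⊆ ⋃ n : ℕ, Ioo (1 / ((n : ℝ) + 1)) (1 / (1 / ((n : ℝ) + 1))) := by
    intro t ht
    have ht : 0 < t := ht
    obtain ⟨n, hn⟩ := exists_nat_gt (max t (1 / t))
    refine mem_iUnion.mpr ⟨n, ?_, ?_⟩
    · rw [one_div_lt (by positivity) ht]
      linarith [le_max_right t (1 / t)]
    · rw [one_div_one_div]
      linarith [le_max_left t (1 / t)]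
  refine (lintegral_mono_set hsub).trans ((lintegral_iUnion_le _ _).trans ?_)
  refine le_of_eq (ENNReal.tsum_eq_zero.mpr fun n => ?_)
  have hδ : 0 < 1 / ((n : ℝ) + 1) := by positivity
  rw [← ofReal_integral_eq_lintegral_ofReal (integrableOn_moment N hK k hδ)]
  · exact ENNReal.ofReal_eq_zero.mpr (hcon _ hδ)
  · refine (ae_restrict_iff' measurableSet_Ioo).mpr (Eventually.of_forall fun t ht => ?_)
    exact mul_nonneg (hKpos t (hδ.trans ht.1)) (Real.rpow_nonneg (hδ.trans ht.1).le _)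

/-- If `K` is a continuous nonnegative kernel on `(0,∞)` with
`∫_0^∞ K(t) t^{N-1+i} dt ∈ (0,∞]` for `i = 2,…,m`, and the ratios
`κ_{i,j}(ε) = (∫_ε^{1/ε} K t^{N-1+j})/(∫_ε^{1/ε} K t^{N-1+i})` tend to `0` as `ε → 0⁺`
whenever `i < j` (`i,j ∈ {2,…,m}`), then `ℋ_m^K(ℝ^N) = ℋ_m^1(ℝ^N)`. -/
theorem HK_eq_H1_of_ratio_lt
    (N : ℕ) (hN : 2 ≤ N) (m : ℕ) (hm : 2 ≤ m) (K : ℝ → ℝ)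
    (hK : ContinuousOn K (Ioi 0)) (hKpos : ∀ t ∈ Ioi (0 : ℝ), 0 ≤ K t)
    (hKint : ∀ i ∈ Finset.Icc 2 m,
      0 < ∫⁻ t in Ioi (0 : ℝ), ENNReal.ofReal (K t * t ^ ((N : ℝ) - 1 + (i : ℝ))))
    (hratio : ∀ i ∈ Finset.Icc 2 m, ∀ j ∈ Finset.Icc 2 m, i < j →
      Tendsto (fun ε : ℝ =>
          (∫ t in Ioo ε (1 / ε), K t * t ^ ((N : ℝ) - 1 + (j : ℝ))) /
          (∫ t in Ioo ε (1 / ε), K t * t ^ ((N : ℝ) - 1 + (i : ℝ))))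
        (𝓝[>] (0 : ℝ)) (𝓝 0)) :
    HK N K m = H1 N m := by
  have hdecomp : ∀ p : MvPolynomial (Fin N) ℝ, p.IsHomogeneous m → ∀ x ε, 0 < ε →
      pvIntK N K (evalE p) x ε = -∑ k ∈ Finset.Icc 1 m,
        sphereInt (MvPolynomial.homogeneousComponent k (mvTranslate x p)) * moment N K k ε :=
    fun p hp x ε hε => pvIntK_evalE hN hK hp.totalDegree_le x hε
  ext u
  refine and_congr_right fun hu => ?_
  obtain ⟨p, hp, hup⟩ := hu
  obtain rfl : u = evalE p := funext hup
  simp only [lap_evalE]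
  constructor
  · intro h x
    set q := mvTranslate x p with hq
    set A : ℕ → ℝ := fun k => sphereInt (MvPolynomial.homogeneousComponent k q)
    have hA1 : A 1 = 0 :=
      sphereInt_eq_zero_of_mvLap_eq_zero hN le_rfl
        (MvPolynomial.homogeneousComponent_isHomogeneous 1 q)
        (mvLap_of_isHomogeneous_one (MvPolynomial.homogeneousComponent_isHomogeneous 1 q))
    obtain ⟨δ, hδ, hMδ⟩ := exists_moment_pos N hK hKpos 2
      (hKint 2 (Finset.mem_Icc.mpr ⟨le_rfl, hm⟩))
    have hM : ∀ᶠ ε in 𝓝[>] (0 : ℝ), 0 < ε ∧ moment N K 2 δ ≤ moment N K 2 ε := by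
      filter_upwards [Ioo_mem_nhdsGT hδ] with ε hε
      exact ⟨hε.1, moment_anti N hK hKpos 2 hε.1 hε.2.le⟩
    have hlim0 : Tendsto (fun ε => pvIntK N K (evalE p) x ε / moment N K 2 ε)
        (𝓝[>] (0 : ℝ)) (𝓝 0) := by
      have h0 : Tendsto (fun ε => |pvIntK N K (evalE p) x ε| / moment N K 2 δ)
          (𝓝[>] (0 : ℝ)) (𝓝 0) := by
        simpa using (h x).abs.div_const (moment N K 2 δ)
      refine squeeze_zero_norm' ?_ h0
      filter_upwards [hM] with ε hε
      rw [norm_div, Real.norm_eq_abs, Real.norm_of_nonneg (hMδ.le.trans hε.2)]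
      exact div_le_div_of_nonneg_left (abs_nonneg _) hMδ hε.2
    have hterm : ∀ k ∈ Finset.Icc 1 m, Tendsto
        (fun ε => A k * (moment N K k ε / moment N K 2 ε)) (𝓝[>] (0 : ℝ))
        (𝓝 (if k = 2 then A 2 else 0)) := by
      intro k hk
      rw [Finset.mem_Icc] at hk
      rcases lt_trichotomy k 2 with hk2 | rfl | hk2
      · obtain rfl : k = 1 := by omega
        simp [hA1]
      · rw [if_pos rfl]
        refine tendsto_const_nhds.congr' ?_
        filter_upwards [hM] with ε hε
        rw [div_self (hMδ.trans_le hε.2).ne', mul_one]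
      · rw [if_neg hk2.ne']
        have hk0 := (hratio 2 (Finset.mem_Icc.mpr ⟨le_rfl, hm⟩) k
          (Finset.mem_Icc.mpr ⟨hk2.le, hk.2⟩) hk2).const_mul (A k)
        rwa [mul_zero] at hk0
    have hlimA : Tendsto (fun ε => pvIntK N K (evalE p) x ε / moment N K 2 ε)
        (𝓝[>] (0 : ℝ)) (𝓝 (-A 2)) := by
      have hsum := (tendsto_finsetSum _ hterm).neg
      rw [Finset.sum_ite_eq', if_pos (Finset.mem_Icc.mpr ⟨one_le_two, hm⟩)] at hsum
      refine hsum.congr' ?_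
      filter_upwards [hM] with ε hε
      rw [hdecomp p hp x ε hε.1, neg_div, Finset.sum_div]
      exact congrArg _ (Finset.sum_congr rfl fun k _ => (mul_div_assoc _ _ _).symm)
    have hA2 : A 2 = 0 := neg_eq_zero.mp (tendsto_nhds_unique hlimA hlim0)
    have hlap := evalE_mvLap_eq_zero_of_sphereInt_eq_zero hN
      (MvPolynomial.homogeneousComponent_isHomogeneous 2 q) hA2 0
    rw [mvLap_homogeneousComponent_add_two 0, MvPolynomial.homogeneousComponent_zero, evalE,
      MvPolynomial.eval_C] at hlap
    have hx : evalE (mvLap q) 0 = evalE (mvLap p) x := by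
      rw [hq, mvLap_mvTranslate, evalE_mvTranslate, add_zero]
    rw [← hx, evalE_zero, hlap]
  · intro h x
    have hlap : mvLap p = 0 :=
      MvPolynomial.funext fun y => by
        simpa [evalE] using h (WithLp.toLp 2 y)
    have hlapq : mvLap (mvTranslate x p) = 0 := by
      rw [mvLap_mvTranslate, hlap, mvTranslate, map_zero]
    refine tendsto_const_nhds.congr' ?_
    filter_upwards [self_mem_nhdsWithin] with ε hε
    rw [hdecomp p hp x ε hε, eq_comm, neg_eq_zero]
    refine Finset.sum_eq_zero fun k hk => ?_
    have hk1 := (Finset.mem_Icc.mp hk).1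
    rw [sphereInt_eq_zero_of_mvLap_eq_zero hN hk1
      (MvPolynomial.homogeneousComponent_isHomogeneous k _)
      (mvLap_homogeneousComponent_eq_zero hlapq hk1), zero_mul]
end
end
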